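/- Quantitative weighted bounds from sparse domination beyond the Banach range: Let T be an m-linear operator (or a positive-valued m-sublinear operator), and suppose there exist r_1,…,r_m ∈ (0,∞), s ∈ [1,∞] such that for all bounded compactly supported f_1,…,f_m,g one has |⟨T(f_1,…,f_m),g⟩| ≲ sup_S Λ_{(r_1,…,r_m,s'),S}(f_1,…,f_m,g), the supremum over all sparse collections S with a fixed sparsity constant. Then for all p_1,…,p_m ∈ (0,∞] with r_j < p_j for all j and p < s (1/p = Σ_j 1/p_j), and all weights w⃗ ∈ A_{p⃗,(r⃗,s)}, T extends to a bounded operator L^{p_1}(w_1^{p_1})×⋯×L^{p_m}(w_m^{p_m}) → L^p(w^p) with ‖T‖_{L^{p_1}(w_1^{p_1})×⋯×L^{p_m}(w_m^{p_m}) → L^p(w^p)} ≲ [w⃗]_{p⃗,(r⃗,s)}^{ max( (1/r_1)/(1/r_1−1/p_1), …, (1/r_m)/(1/r_m−1/p_m), (1−1/s)/(1/p−1/s) ) }. -/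

import Mathlib

open MeasureTheory ENNReal

noncomputable section

namespace Paper

/-- An axis-parallel (half-open) cube in `ℝⁿ` with positive side length. -/
def IsCube {n : ℕ} (Q : Set (Fin n → ℝ)) : Prop :=
  ∃ (c : Fin n → ℝ) (h : ℝ), 0 < h ∧
    Q = Set.univ.pi fun i => Set.Ico (c i) (c i + h)

/-- A weight on `ℝⁿ`: a measurable, everywhere positive function. -/
def IsWeight {n : ℕ} (w : (Fin n → ℝ) → ℝ) : Prop :=
  Measurable w ∧ ∀ x, 0 < w x

/-- `expOf ρ` is the exponent `1/ρ ∈ (0,∞]`; `ρ = 0` encodes the exponent `∞`. -/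
def expOf (ρ : ℝ) : ℝ≥0∞ := if ρ = 0 then ∞ else ENNReal.ofReal (1 / ρ)

/-- The average `⟨f⟩_{1/τ, Q}` of a real-valued `f` over `Q`;
`τ = 0` encodes the essential supremum `⟨f⟩_{∞,Q}`. -/
def avg {n : ℕ} (τ : ℝ) (f : (Fin n → ℝ) → ℝ) (Q : Set (Fin n → ℝ)) : ℝ≥0∞ :=
  if τ = 0 then essSup (fun x => ENNReal.ofReal |f x|) (volume.restrict Q)
  else ((volume Q)⁻¹ * ∫⁻ x in Q, ENNReal.ofReal |f x| ^ (1 / τ)) ^ τ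

/-- The average `⟨g⟩_{1/τ, Q}` of an `ℝ≥0∞`-valued `g` over `Q`. -/
def avgE {n : ℕ} (τ : ℝ) (g : (Fin n → ℝ) → ℝ≥0∞) (Q : Set (Fin n → ℝ)) : ℝ≥0∞ :=
  if τ = 0 then essSup g (volume.restrict Q)
  else ((volume Q)⁻¹ * ∫⁻ x in Q, g x ^ (1 / τ)) ^ τ

/-- The weighted norm `‖f‖_{L^{1/ρ}(w^{1/ρ})} = ‖f·w‖_{L^{1/ρ}(ℝⁿ)}`;
`ρ = 0` encodes `p = ∞`. -/
def wnorm {n : ℕ} (ρ : ℝ) (f w : (Fin n → ℝ) → ℝ) : ℝ≥0∞ :=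
  eLpNorm (fun x => f x * w x) (expOf ρ) volume

/-- The weighted norm `‖g·w‖_{L^{1/ρ}}` of an `ℝ≥0∞`-valued function `g`. -/
def wnormE {n : ℕ} (ρ : ℝ) (g : (Fin n → ℝ) → ℝ≥0∞) (w : (Fin n → ℝ) → ℝ) : ℝ≥0∞ :=
  if ρ = 0 then essSup (fun x => g x * ENNReal.ofReal (w x)) volume
  else (∫⁻ x, (g x * ENNReal.ofReal (w x)) ^ (1 / ρ)) ^ ρ

/-- The weak weighted norm `‖f‖_{L^{1/ρ,∞}(w^{1/ρ})}
  = sup_{t>0} t · (∫_{|f|>t} w^{1/ρ})^{ρ}`; `ρ = 0` encodes `p = ∞`. -/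
def wWeakNorm {n : ℕ} (ρ : ℝ) (f w : (Fin n → ℝ) → ℝ) : ℝ≥0∞ :=
  if ρ = 0 then wnorm 0 f w
  else ⨆ t : Set.Ioi (0 : ℝ),
    ENNReal.ofReal t.1 *
      (∫⁻ x in {x | t.1 < |f x|}, ENNReal.ofReal (w x) ^ (1 / ρ)) ^ ρ

/-- The weak weighted norm of an `ℝ≥0∞`-valued function. -/
def wWeakNormE {n : ℕ} (ρ : ℝ) (g : (Fin n → ℝ) → ℝ≥0∞) (w : (Fin n → ℝ) → ℝ) : ℝ≥0∞ :=
  if ρ = 0 then essSup (fun x => g x * ENNReal.ofReal (w x)) volume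
  else ⨆ t : Set.Ioi (0 : ℝ),
    ENNReal.ofReal t.1 *
      (∫⁻ x in {x | ENNReal.ofReal t.1 < g x}, ENNReal.ofReal (w x) ^ (1 / ρ)) ^ ρ

/-- The weak `L¹(ℝⁿ)` quasinorm (with respect to Lebesgue measure) of an
`ℝ≥0∞`-valued function. -/
def weakL1 {n : ℕ} (g : (Fin n → ℝ) → ℝ≥0∞) : ℝ≥0∞ :=
  ⨆ t : Set.Ioi (0 : ℝ), ENNReal.ofReal t.1 * volume {x | ENNReal.ofReal t.1 < g x}

/-- The limited range multilinear weight constant `[w⃗]_{p⃗,(r⃗,s)}`, written in terms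
of the reciprocal exponents `rinv j = 1/r_j`, `pinv j = 1/p_j` and `sinv = 1/s`. -/
def wConst {n m : ℕ} (rinv pinv : Fin m → ℝ) (sinv : ℝ)
    (w : Fin m → (Fin n → ℝ) → ℝ) : ℝ≥0∞ :=
  ⨆ Q : {Q : Set (Fin n → ℝ) // IsCube Q},
    (∏ j, avg (rinv j - pinv j) (fun x => (w j x)⁻¹) Q.1) *
      avg ((∑ j, pinv j) - sinv) (fun x => ∏ j, w j x) Q.1

/-- The symmetric weight constant `[w⃗]_{p⃗,(r⃗,∞)} = sup_Q ∏_j ⟨w_j⁻¹⟩_{1/(1/r_j - 1/p_j),Q}`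
for tuples of weights with `∏_j w_j = 1`. -/
def wConstS {n m : ℕ} (rinv pinv : Fin m → ℝ)
    (w : Fin m → (Fin n → ℝ) → ℝ) : ℝ≥0∞ :=
  ⨆ Q : {Q : Set (Fin n → ℝ) // IsCube Q},
    ∏ j, avg (rinv j - pinv j) (fun x => (w j x)⁻¹) Q.1

/-- The multisublinear Hardy-Littlewood maximal operator
`M_{(r_1,…,r_m)}(f⃗)(x) = sup_{Q ∋ x} ∏_j ⟨f_j⟩_{r_j,Q}` (reciprocal exponents). -/
def maximal {n m : ℕ} (rinv : Fin m → ℝ)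
    (f : Fin m → (Fin n → ℝ) → ℝ) (x : Fin n → ℝ) : ℝ≥0∞ :=
  ⨆ Q : {Q : Set (Fin n → ℝ) // IsCube Q ∧ x ∈ Q}, ∏ j, avg (rinv j) (f j) Q.1

/-- A sparse family of cubes (with sparsity constant 2): to each cube `Q` of the family
is associated a major subset `E Q ⊆ Q` with `|Q| ≤ 2|E Q|`, and these sets are
pairwise disjoint. -/
structure SparseFamily (n : ℕ) where
  cubes : Set (Set (Fin n → ℝ))
  E : Set (Fin n → ℝ) → Set (Fin n → ℝ)
  isCube : ∀ Q ∈ cubes, IsCube Q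
  E_subset : ∀ Q ∈ cubes, E Q ⊆ Q
  E_meas : ∀ Q ∈ cubes, MeasurableSet (E Q)
  E_disj : ∀ Q ∈ cubes, ∀ Q' ∈ cubes, Q ≠ Q' → Disjoint (E Q) (E Q')
  density : ∀ Q ∈ cubes, volume Q ≤ 2 * volume (E Q)

/-- The sparse form `Λ_{r⃗,S}(f⃗) = ∑_{Q∈S} (∏_j ⟨f_j⟩_{r_j,Q}) |Q|`. -/
def sparseForm {n m : ℕ} (rinv : Fin m → ℝ) (S : SparseFamily n)
    (f : Fin m → (Fin n → ℝ) → ℝ) : ℝ≥0∞ :=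
  ∑' Q : S.cubes, (∏ j, avg (rinv j) (f j) Q.1) * volume Q.1

/-- The sparse operator `A_{r⃗,S}(f⃗) = ∑_{Q∈S} (∏_j ⟨f_j⟩_{r_j,Q}) χ_Q`. -/
def sparseOp {n m : ℕ} (rinv : Fin m → ℝ) (S : SparseFamily n)
    (f : Fin m → (Fin n → ℝ) → ℝ) (x : Fin n → ℝ) : ℝ≥0∞ :=
  ∑' Q : S.cubes, (∏ j, avg (rinv j) (f j) Q.1) *
    (Q.1).indicator (fun _ => (1 : ℝ≥0∞)) x

end Paper
namespace Paper

/-- A dyadic cube of generation `k` (side length `2^k`). -/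
def IsDyadicCube {n : ℕ} (k : ℤ) (Q : Set (Fin n → ℝ)) : Prop :=
  ∃ c : Fin n → ℝ, Q = Set.univ.pi fun i => Set.Ico (c i) (c i + 2 ^ k)

/-- A dyadic grid on `ℝⁿ`: a family of dyadic cubes of all generations whose members are
nested or disjoint, and such that every point lies in a cube of every generation. -/
def IsDyadicGrid {n : ℕ} (D : Set (Set (Fin n → ℝ))) : Prop :=
  (∀ Q ∈ D, ∃ k : ℤ, IsDyadicCube k Q) ∧
  (∀ Q ∈ D, ∀ Q' ∈ D, Q ⊆ Q' ∨ Q' ⊆ Q ∨ Disjoint Q Q') ∧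
  (∀ (k : ℤ) (x : Fin n → ℝ), ∃ Q ∈ D, x ∈ Q ∧ IsDyadicCube k Q)

/-- The dyadic multisublinear maximal operator `M^D_{(r_1,…,r_m)}`. -/
def dyadicMaximal {n m : ℕ} (D : Set (Set (Fin n → ℝ))) (rinv : Fin m → ℝ)
    (f : Fin m → (Fin n → ℝ) → ℝ) (x : Fin n → ℝ) : ℝ≥0∞ :=
  ⨆ Q : {Q : Set (Fin n → ℝ) // Q ∈ D ∧ x ∈ Q}, ∏ j, avg (rinv j) (f j) Q.1

/-- `T` is `m`-linear: linear in each coordinate separately. -/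
def IsMLinear {n m : ℕ} (T : (Fin m → (Fin n → ℝ) → ℝ) → (Fin n → ℝ) → ℝ) : Prop :=
  ∀ (f : Fin m → (Fin n → ℝ) → ℝ) (j : Fin m) (c : ℝ) (g g' : (Fin n → ℝ) → ℝ),
    T (Function.update f j (fun x => c * g x + g' x)) =
      fun x => c * T (Function.update f j g) x + T (Function.update f j g') x

/-- `T` is positive-valued and `m`-sublinear: subadditive and positively homogeneous
in each coordinate separately. -/
def IsMSublinearPos {n m : ℕ} (T : (Fin m → (Fin n → ℝ) → ℝ) → (Fin n → ℝ) → ℝ) : Prop :=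
  (∀ f x, 0 ≤ T f x) ∧
  (∀ (f : Fin m → (Fin n → ℝ) → ℝ) (j : Fin m) (g g' : (Fin n → ℝ) → ℝ) (x : Fin n → ℝ),
    T (Function.update f j (fun y => g y + g' y)) x ≤
      T (Function.update f j g) x + T (Function.update f j g') x) ∧
  (∀ (f : Fin m → (Fin n → ℝ) → ℝ) (j : Fin m) (c : ℝ) (g : (Fin n → ℝ) → ℝ)
    (x : Fin n → ℝ), 0 ≤ c →
    T (Function.update f j (fun y => c * g y)) x = c * T (Function.update f j g) x)

/-- A simple function: measurable with finitely many values. -/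
def IsSimpleFn {n : ℕ} (f : (Fin n → ℝ) → ℝ) : Prop :=
  Measurable f ∧ (Set.range f).Finite

/-- A bounded, compactly supported (measurable) function. -/
def BddCompSupp {n : ℕ} (f : (Fin n → ℝ) → ℝ) : Prop :=
  Measurable f ∧ (∃ M : ℝ, ∀ x, |f x| ≤ M) ∧ HasCompactSupport f

/-- The `ℓ^{1/σ}` norm of a sequence; `σ = 0` encodes `ℓ^∞`. -/
def lqNorm (σ : ℝ) (F : ℕ → ℝ) : ℝ≥0∞ :=
  if σ = 0 then ⨆ k, ENNReal.ofReal |F k|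
  else (∑' k, ENNReal.ofReal |F k| ^ (1 / σ)) ^ σ

end Paper
namespace Paper

section CenteredMaximal

variable {α : Type*} [MetricSpace α] [SecondCountableTopology α] [MeasurableSpace α]
  [BorelSpace α]

/-- The centered Hardy-Littlewood maximal function with respect to `μ`, over balls of rational
radius. -/
def centeredMax (μ : Measure α) (F : α → ℝ≥0∞) (x : α) : ℝ≥0∞ :=
  ⨆ q : {q : ℚ // 0 < q},
    (μ (Metric.ball x (q.1 : ℝ)))⁻¹ * ∫⁻ y in Metric.ball x (q.1 : ℝ), F y ∂μ

lemma measurable_setLIntegral_ball (μ : Measure α) [SFinite μ] {F : α → ℝ≥0∞}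
    (hF : Measurable F) (r : ℝ) :
    Measurable fun x => ∫⁻ y in Metric.ball x r, F y ∂μ := by
  have h : ∀ x, ∫⁻ y in Metric.ball x r, F y ∂μ
      = ∫⁻ y, ({p : α × α | dist p.2 p.1 < r}.indicator fun p => F p.2) (x, y) ∂μ := by
    intro x
    rw [← lintegral_indicator Metric.isOpen_ball.measurableSet]
    rfl
  simp_rw [h]
  refine Measurable.lintegral_prod_right' (f := {p : α × α | dist p.2 p.1 < r}.indicator
    fun p => F p.2) ?_
  exact (hF.comp measurable_snd).indicator
    (measurableSet_lt (measurable_snd.dist measurable_fst) measurable_const)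

lemma measurable_centeredMax (μ : Measure α) [SFinite μ] {F : α → ℝ≥0∞} (hF : Measurable F) :
    Measurable (centeredMax μ F) := by
  refine Measurable.iSup fun q => ?_
  refine Measurable.mul ?_ (measurable_setLIntegral_ball μ hF _)
  have := measurable_setLIntegral_ball μ (F := fun _ => 1) measurable_const (q.1 : ℝ)
  simp only [setLIntegral_one] at this
  exact this.inv

omit [SecondCountableTopology α] [BorelSpace α] in
lemma setLIntegral_ball_le_centeredMax (μ : Measure α) (F : α → ℝ≥0∞) (x : α) {q : ℚ}
    (hq : 0 < q) (h0 : μ (Metric.ball x (q : ℝ)) ≠ 0) (ht : μ (Metric.ball x (q : ℝ)) ≠ ∞) :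
    ∫⁻ y in Metric.ball x (q : ℝ), F y ∂μ ≤ μ (Metric.ball x (q : ℝ)) * centeredMax μ F x := by
  have h : (μ (Metric.ball x (q : ℝ)))⁻¹ * ∫⁻ y in Metric.ball x (q : ℝ), F y ∂μ
      ≤ centeredMax μ F x :=
    le_iSup (fun q : {q : ℚ // 0 < q} =>
      (μ (Metric.ball x (q.1 : ℝ)))⁻¹ * ∫⁻ y in Metric.ball x (q.1 : ℝ), F y ∂μ) ⟨q, hq⟩
  calc ∫⁻ y in Metric.ball x (q : ℝ), F y ∂μ
      = μ (Metric.ball x (q : ℝ)) * ((μ (Metric.ball x (q : ℝ)))⁻¹ *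
        ∫⁻ y in Metric.ball x (q : ℝ), F y ∂μ) := by
        rw [← mul_assoc, ENNReal.mul_inv_cancel h0 ht, one_mul]
    _ ≤ _ := by gcongr

omit [SecondCountableTopology α] [BorelSpace α] in
lemma centeredMax_le_of_ae_le (μ : Measure α) {F : α → ℝ≥0∞} {B : ℝ≥0∞}
    (h : ∀ᵐ x ∂μ, F x ≤ B) (x : α) : centeredMax μ F x ≤ B := by
  refine iSup_le fun q => ?_
  calc (μ (Metric.ball x (q.1 : ℝ)))⁻¹ * ∫⁻ y in Metric.ball x (q.1 : ℝ), F y ∂μ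
      ≤ (μ (Metric.ball x (q.1 : ℝ)))⁻¹ * ∫⁻ _ in Metric.ball x (q.1 : ℝ), B ∂μ := by
        exact mul_le_mul' le_rfl (lintegral_mono_ae (ae_restrict_of_ae h))
    _ = ((μ (Metric.ball x (q.1 : ℝ)))⁻¹ * μ (Metric.ball x (q.1 : ℝ))) * B := by
        rw [setLIntegral_const]; ring
    _ ≤ 1 * B := by gcongr; exact ENNReal.inv_mul_le_one _
    _ = B := one_mul B

omit [SecondCountableTopology α] [BorelSpace α] in
lemma centeredMax_le_add (μ : Measure α) {F G : α → ℝ≥0∞} {B : ℝ≥0∞} (hG : Measurable G)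
    (h : ∀ x, F x ≤ G x + B) (x : α) : centeredMax μ F x ≤ centeredMax μ G x + B := by
  refine iSup_le fun q => ?_
  calc (μ (Metric.ball x (q.1 : ℝ)))⁻¹ * ∫⁻ y in Metric.ball x (q.1 : ℝ), F y ∂μ
      ≤ (μ (Metric.ball x (q.1 : ℝ)))⁻¹ * ∫⁻ y in Metric.ball x (q.1 : ℝ), (G y + B) ∂μ := by
        exact mul_le_mul' le_rfl (lintegral_mono h)
    _ = (μ (Metric.ball x (q.1 : ℝ)))⁻¹ * ∫⁻ y in Metric.ball x (q.1 : ℝ), G y ∂μ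
        + ((μ (Metric.ball x (q.1 : ℝ)))⁻¹ * μ (Metric.ball x (q.1 : ℝ))) * B := by
        rw [lintegral_add_left hG, setLIntegral_const]; ring
    _ ≤ centeredMax μ G x + 1 * B := by
        gcongr
        · exact le_iSup (fun q : {q : ℚ // 0 < q} => (μ (Metric.ball x (q.1 : ℝ)))⁻¹ *
            ∫⁻ y in Metric.ball x (q.1 : ℝ), G y ∂μ) q
        · exact ENNReal.inv_mul_le_one _
    _ = _ := by rw [one_mul]

/-- The Besicovitch covering theorem bounds the measure of the centers of bounded families of
balls. -/
lemma measure_le_of_ball_le {N : ℕ} {τ : ℝ} (hτ : 1 < τ)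
    (hN : IsEmpty (Besicovitch.SatelliteConfig α N τ)) (μ : Measure α) (F : α → ℝ≥0∞)
    {t : ℝ≥0∞} (S : Set α) (R : ℝ)
    (hS : ∀ x ∈ S, ∃ r : ℝ, 0 < r ∧ r ≤ R ∧
      t * μ (Metric.ball x r) ≤ ∫⁻ y in Metric.ball x r, F y ∂μ) :
    t * μ S ≤ N * ∫⁻ y, F y ∂μ := by
  choose r hr0 hrR hr using hS
  let p : Besicovitch.BallPackage S α :=
    { c := fun x => x.1
      r := fun x => r x.1 x.2
      rpos := fun x => hr0 _ _
      r_bound := R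
      r_le := fun x => hrR _ _ }
  obtain ⟨s, hs, hcov⟩ := Besicovitch.exist_disjoint_covering_families hτ hN p
  have hSc : S ⊆ ⋃ i : Fin N, ⋃ j ∈ s i, Metric.ball (p.c j) (p.r j) := by
    refine subset_trans ?_ hcov
    intro x hx
    exact ⟨⟨x, hx⟩, rfl⟩
  have hdis : ∀ i, (s i).PairwiseDisjoint fun j => Metric.ball (p.c j) (p.r j) := fun i =>
    (hs i).mono fun j => Metric.ball_subset_closedBall
  have hct : ∀ i, (s i).Countable := fun i =>
    (hdis i).countable_of_isOpen (fun _ _ => Metric.isOpen_ball)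
      fun j _ => Metric.nonempty_ball.2 (p.rpos j)
  have hone : ∀ i, t * μ (⋃ j ∈ s i, Metric.ball (p.c j) (p.r j)) ≤ ∫⁻ y, F y ∂μ := by
    intro i
    rw [measure_biUnion (hct i) (hdis i) fun _ _ => Metric.isOpen_ball.measurableSet,
      ← ENNReal.tsum_mul_left]
    calc ∑' j : s i, t * μ (Metric.ball (p.c j) (p.r j))
        ≤ ∑' j : s i, ∫⁻ y in Metric.ball (p.c j) (p.r j), F y ∂μ :=
          ENNReal.tsum_le_tsum fun j => hr _ _
      _ = ∫⁻ y in ⋃ j ∈ s i, Metric.ball (p.c j) (p.r j), F y ∂μ :=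
          (lintegral_biUnion (hct i) (fun _ _ => Metric.isOpen_ball.measurableSet)
            (hdis i) F).symm
      _ ≤ _ := setLIntegral_le_lintegral _ _
  calc t * μ S ≤ t * ∑ i : Fin N, μ (⋃ j ∈ s i, Metric.ball (p.c j) (p.r j)) := by
        gcongr
        refine (measure_mono hSc).trans ?_
        exact measure_iUnion_fintype_le μ _
    _ = ∑ i : Fin N, t * μ (⋃ j ∈ s i, Metric.ball (p.c j) (p.r j)) := Finset.mul_sum _ _ _
    _ ≤ ∑ _i : Fin N, ∫⁻ y, F y ∂μ := Finset.sum_le_sum fun i _ => hone i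
    _ = _ := by simp

/-- The weak type `(1,1)` bound for the centered maximal function. -/
lemma centeredMax_weak {N : ℕ} {τ : ℝ} (hτ : 1 < τ)
    (hN : IsEmpty (Besicovitch.SatelliteConfig α N τ)) (μ : Measure α) (F : α → ℝ≥0∞)
    (t : ℝ≥0∞) : t * μ {x | t < centeredMax μ F x} ≤ N * ∫⁻ y, F y ∂μ := by
  let S : ℕ → Set α := fun k => {x | ∃ q : {q : ℚ // 0 < q}, (q.1 : ℝ) ≤ k ∧
    t < (μ (Metric.ball x (q.1 : ℝ)))⁻¹ * ∫⁻ y in Metric.ball x (q.1 : ℝ), F y ∂μ}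
  have hmono : Monotone S := by
    rintro a b hab x ⟨q, hq, h⟩
    exact ⟨q, hq.trans (by exact_mod_cast hab), h⟩
  have hU : {x | t < centeredMax μ F x} = ⋃ k, S k := by
    ext x
    simp only [Set.mem_ofPred_eq, centeredMax, lt_iSup_iff, Set.mem_iUnion, S]
    constructor
    · rintro ⟨q, hq⟩
      obtain ⟨k, hk⟩ := exists_nat_ge (q.1 : ℝ)
      exact ⟨k, q, hk, hq⟩
    · rintro ⟨k, q, -, hq⟩
      exact ⟨q, hq⟩
  rw [hU, hmono.measure_iUnion, ENNReal.mul_iSup]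
  refine iSup_le fun k => measure_le_of_ball_le hτ hN μ F (S k) k ?_
  rintro x ⟨q, hqk, hq⟩
  refine ⟨q.1, by exact_mod_cast q.2, hqk, ?_⟩
  refine ENNReal.mul_le_of_le_div ?_
  rw [div_eq_mul_inv, mul_comm]
  exact hq.le

end CenteredMaximal

lemma rpow_le_tsum_dyadic (a : ℝ≥0∞) {q : ℝ} (hq : 0 < q) :
    a ^ q ≤ ∑' l : ℤ, (4 * (2 : ℝ≥0∞) ^ l) ^ q * (if 2 * (2 : ℝ≥0∞) ^ l < a then 1 else 0) := by
  have h2 : (2 : ℝ≥0∞) ≠ 0 := two_ne_zero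
  have h2' : (2 : ℝ≥0∞) ≠ ∞ := ofNat_ne_top
  rcases eq_or_ne a 0 with rfl | h0
  · simp [ENNReal.zero_rpow_of_pos hq]
  rcases eq_or_ne a ∞ with rfl | ht
  · have h1 : ∀ i : ℕ, (1 : ℝ≥0∞) ≤ (4 * (2 : ℝ≥0∞) ^ (i : ℤ)) ^ q *
        (if 2 * (2 : ℝ≥0∞) ^ (i : ℤ) < ∞ then 1 else 0) := by
      intro i
      rw [if_pos (ENNReal.mul_lt_top h2'.lt_top (ENNReal.zpow_lt_top h2 h2' _)), mul_one]
      refine ENNReal.one_le_rpow ?_ hq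
      refine one_le_mul (by norm_num) ?_
      rw [zpow_natCast]
      exact one_le_pow₀ (by norm_num)
    have h3 : ∑' _i : ℕ, (1 : ℝ≥0∞) = ∞ := ENNReal.tsum_const_eq_top_of_ne_zero one_ne_zero
    refine le_top.trans (h3.symm.le.trans ?_)
    refine (ENNReal.tsum_le_tsum h1).trans ?_
    exact ENNReal.tsum_comp_le_tsum_of_injective (Nat.cast_injective (R := ℤ))
      fun l : ℤ => (4 * (2 : ℝ≥0∞) ^ l) ^ q * (if 2 * (2 : ℝ≥0∞) ^ l < ∞ then 1 else 0)
  obtain ⟨n, hn1, hn2⟩ := ENNReal.exists_mem_Ioc_zpow h0 ht (y := 2) (by norm_num) h2'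
  have e1 : 2 * (2 : ℝ≥0∞) ^ (n - 1) = 2 ^ n := by
    conv_rhs => rw [show n = 1 + (n - 1) by ring, ENNReal.zpow_add h2 h2', zpow_one]
  have e2 : 4 * (2 : ℝ≥0∞) ^ (n - 1) = 2 ^ (n + 1) := by
    rw [show (4 : ℝ≥0∞) = 2 * 2 by norm_num, mul_assoc, e1, ENNReal.zpow_add h2 h2', zpow_one,
      mul_comm]
  refine le_trans ?_ (ENNReal.le_tsum (n - 1))
  rw [e1, if_pos hn1, mul_one, e2]
  exact ENNReal.rpow_le_rpow hn2 hq.le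

lemma exists_tsum_dyadic_le {q : ℝ} (hq : 0 < q) :
    ∃ K : ℝ≥0∞, K ≠ ∞ ∧ ∀ a : ℝ≥0∞,
      ∑' l : ℤ, ((2 : ℝ≥0∞) ^ l) ^ q * (if (2 : ℝ≥0∞) ^ l < a then 1 else 0) ≤ K * a ^ q := by
  have h2 : (2 : ℝ≥0∞) ≠ 0 := two_ne_zero
  have h2' : (2 : ℝ≥0∞) ≠ ∞ := ofNat_ne_top
  have hlt : (2 : ℝ≥0∞) ^ (-q) < 1 := ENNReal.rpow_lt_one_of_one_lt_of_neg (by norm_num) (by linarith)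
  refine ⟨(1 - (2 : ℝ≥0∞) ^ (-q))⁻¹, ?_, fun a => ?_⟩
  · rw [Ne, ENNReal.inv_eq_top]
    exact (tsub_pos_of_lt hlt).ne'
  rcases eq_or_ne a 0 with rfl | h0
  · simp
  rcases eq_or_ne a ∞ with rfl | ht
  · rw [ENNReal.top_rpow_of_pos hq, ENNReal.mul_top]
    · exact le_top
    · rw [Ne, ENNReal.inv_eq_zero]
      exact (tsub_le_self.trans_lt one_lt_top).ne
  obtain ⟨n, hn1, hn2⟩ := ENNReal.exists_mem_Ioc_zpow h0 ht (y := 2) (by norm_num) h2'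
  have hinj : Function.Injective fun i : ℕ => n - (i : ℤ) := fun i j h => by
    simpa using h
  rw [← hinj.tsum_eq]
  · calc ∑' i : ℕ, ((2 : ℝ≥0∞) ^ (n - (i : ℤ))) ^ q *
          (if (2 : ℝ≥0∞) ^ (n - (i : ℤ)) < a then 1 else 0)
        ≤ ∑' i : ℕ, a ^ q * ((2 : ℝ≥0∞) ^ (-q)) ^ i := by
          refine ENNReal.tsum_le_tsum fun i => ?_
          refine (mul_le_of_le_one_right' (by split_ifs <;> simp)).trans ?_
          have : ((2 : ℝ≥0∞) ^ (n - (i : ℤ))) ^ q = ((2 : ℝ≥0∞) ^ n) ^ q * ((2 : ℝ≥0∞) ^ (-q)) ^ i := by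
            rw [← ENNReal.rpow_intCast, ← ENNReal.rpow_intCast, ← ENNReal.rpow_natCast,
              ← ENNReal.rpow_mul, ← ENNReal.rpow_mul, ← ENNReal.rpow_mul,
              ← ENNReal.rpow_add _ _ h2 h2']
            congr 1
            push_cast
            ring
          rw [this]
          gcongr
      _ = _ := by rw [ENNReal.tsum_mul_left, ENNReal.tsum_geometric, mul_comm]
  · intro l hl
    have hl' : (2 : ℝ≥0∞) ^ l < a := by
      by_contra h
      simp [h] at hl
    have hln : l ≤ n := by
      by_contra! h
      have : (2 : ℝ≥0∞) ^ (n + 1) ≤ 2 ^ l := ENNReal.zpow_le_of_le (by norm_num) (by omega)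
      exact absurd (hn2.trans this) (not_le.2 hl')
    exact ⟨(n - l).toNat, by simp; omega⟩

section CenteredMaximal

variable {α : Type*} [MetricSpace α] [SecondCountableTopology α] [MeasurableSpace α]
  [BorelSpace α]

lemma measure_lt_centeredMax_le {N : ℕ} {τ : ℝ} (hτ : 1 < τ)
    (hN : IsEmpty (Besicovitch.SatelliteConfig α N τ)) (μ : Measure α) {F : α → ℝ≥0∞}
    (hF : Measurable F) {s : ℝ≥0∞} (hs : s ≠ 0) (hs' : s ≠ ∞) :
    μ {x | 2 * s < centeredMax μ F x} ≤
      s⁻¹ * (N * ∫⁻ y, F y * (if s < F y then 1 else 0) ∂μ) := by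
  let G : α → ℝ≥0∞ := fun y => F y * (if s < F y then 1 else 0)
  have hG : Measurable G := hF.mul
    (Measurable.ite (measurableSet_lt measurable_const hF) measurable_const measurable_const)
  have hFG : ∀ y, F y ≤ G y + s := by
    intro y
    by_cases h : s < F y
    · simp [G, h]
    · simpa [G, h] using not_lt.1 h
  have hsub : {x | 2 * s < centeredMax μ F x} ⊆ {x | s < centeredMax μ G x} := by
    intro x hx
    have h1 := centeredMax_le_add μ hG hFG x
    have h2 : s + s < centeredMax μ G x + s := by
      rw [← two_mul]
      exact lt_of_lt_of_le hx h1
    exact (ENNReal.add_lt_add_iff_right hs').1 h2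
  calc μ {x | 2 * s < centeredMax μ F x} ≤ μ {x | s < centeredMax μ G x} := measure_mono hsub
    _ = s⁻¹ * (s * μ {x | s < centeredMax μ G x}) := by
        rw [← mul_assoc, ENNReal.inv_mul_cancel hs hs', one_mul]
    _ ≤ _ := mul_le_mul' le_rfl (centeredMax_weak hτ hN μ G s)

/-- The strong type `(q,q)` bound for the centered maximal function, uniform in the measure. -/
lemma exists_lintegral_centeredMax_rpow_le (α : Type*) [MetricSpace α]
    [SecondCountableTopology α] [MeasurableSpace α] [BorelSpace α] [HasBesicovitchCovering α]
    {q : ℝ} (hq : 1 < q) :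
    ∃ K : ℝ≥0∞, K ≠ ∞ ∧ ∀ (μ : Measure α) [SFinite μ] (F : α → ℝ≥0∞), Measurable F →
      ∫⁻ x, centeredMax μ F x ^ q ∂μ ≤ K * ∫⁻ x, F x ^ q ∂μ := by
  obtain ⟨N, τ, hτ, hN⟩ := HasBesicovitchCovering.no_satelliteConfig (α := α)
  obtain ⟨K, hK, hKs⟩ := exists_tsum_dyadic_le (q := q - 1) (by linarith)
  have h2 : (2 : ℝ≥0∞) ≠ 0 := two_ne_zero
  have h2' : (2 : ℝ≥0∞) ≠ ∞ := ofNat_ne_top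
  have hz : ∀ l : ℤ, (2 : ℝ≥0∞) ^ l ≠ 0 := fun l => (ENNReal.zpow_pos h2 h2' l).ne'
  have hz' : ∀ l : ℤ, (2 : ℝ≥0∞) ^ l ≠ ∞ := fun l => (ENNReal.zpow_lt_top h2 h2' l).ne
  refine ⟨(4 : ℝ≥0∞) ^ q * N * K, ?_, fun μ _ F hF => ?_⟩
  · exact ENNReal.mul_ne_top (ENNReal.mul_ne_top
      (ENNReal.rpow_ne_top_of_nonneg (by linarith) ofNat_ne_top) (natCast_ne_top N)) hK
  have hite : ∀ {H : α → ℝ≥0∞}, Measurable H → ∀ s : ℝ≥0∞,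
      Measurable fun x => if s < H x then (1 : ℝ≥0∞) else 0 := fun hH s =>
    Measurable.ite (measurableSet_lt measurable_const hH) measurable_const measurable_const
  have hM := measurable_centeredMax μ hF
  calc ∫⁻ x, centeredMax μ F x ^ q ∂μ
      ≤ ∫⁻ x, ∑' l : ℤ, (4 * (2 : ℝ≥0∞) ^ l) ^ q *
          (if 2 * (2 : ℝ≥0∞) ^ l < centeredMax μ F x then 1 else 0) ∂μ :=
        lintegral_mono fun x => rpow_le_tsum_dyadic _ (by linarith)
    _ = ∑' l : ℤ, (4 * (2 : ℝ≥0∞) ^ l) ^ q * μ {x | 2 * (2 : ℝ≥0∞) ^ l < centeredMax μ F x} := by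
        rw [lintegral_tsum fun l => ((hite hM _).const_mul _).aemeasurable]
        refine tsum_congr fun l => ?_
        rw [lintegral_const_mul _ (hite hM _)]
        congr 1
        have := lintegral_indicator_one (μ := μ)
          (measurableSet_lt (measurable_const (a := 2 * (2 : ℝ≥0∞) ^ l)) hM)
        rw [← this]
        simp only [Set.indicator_apply, Set.mem_ofPred_eq, Pi.one_apply]
    _ ≤ ∑' l : ℤ, (4 * (2 : ℝ≥0∞) ^ l) ^ q * (((2 : ℝ≥0∞) ^ l)⁻¹ *
          (N * ∫⁻ y, F y * (if (2 : ℝ≥0∞) ^ l < F y then 1 else 0) ∂μ)) := by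
        gcongr with l
        exact measure_lt_centeredMax_le hτ hN μ hF (hz l) (hz' l)
    _ = ∑' l : ℤ, ∫⁻ y, (4 : ℝ≥0∞) ^ q * N * (F y * (((2 : ℝ≥0∞) ^ l) ^ (q - 1) *
          (if (2 : ℝ≥0∞) ^ l < F y then 1 else 0))) ∂μ := by
        refine tsum_congr fun l => ?_
        have e : ∀ y, (4 : ℝ≥0∞) ^ q * N * (F y * (((2 : ℝ≥0∞) ^ l) ^ (q - 1) *
          (if (2 : ℝ≥0∞) ^ l < F y then 1 else 0))) = ((4 : ℝ≥0∞) ^ q * N *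
            ((2 : ℝ≥0∞) ^ l) ^ (q - 1)) * (F y * (if (2 : ℝ≥0∞) ^ l < F y then 1 else 0)) :=
          fun y => by ring
        simp_rw [e]
        have hm : Measurable fun y => F y * (if (2 : ℝ≥0∞) ^ l < F y then 1 else 0) :=
          hF.mul (hite hF _)
        rw [lintegral_const_mul _ hm, ENNReal.mul_rpow_of_nonneg _ _ (by linarith),
          ENNReal.rpow_sub _ _ (hz l) (hz' l), ENNReal.rpow_one, div_eq_mul_inv]
        ring
    _ = ∫⁻ y, (4 : ℝ≥0∞) ^ q * N * (F y * ∑' l : ℤ, (((2 : ℝ≥0∞) ^ l) ^ (q - 1) *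
          (if (2 : ℝ≥0∞) ^ l < F y then 1 else 0))) ∂μ := by
        have hm : ∀ l : ℤ, Measurable fun y => (4 : ℝ≥0∞) ^ q * N * (F y *
            (((2 : ℝ≥0∞) ^ l) ^ (q - 1) * (if (2 : ℝ≥0∞) ^ l < F y then 1 else 0))) := fun l =>
          (hF.mul ((hite hF _).const_mul _)).const_mul _
        rw [← lintegral_tsum fun l => (hm l).aemeasurable]
        simp_rw [ENNReal.tsum_mul_left]
    _ ≤ ∫⁻ y, (4 : ℝ≥0∞) ^ q * N * K * F y ^ q ∂μ := by
        refine lintegral_mono fun y => ?_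
        calc (4 : ℝ≥0∞) ^ q * N * (F y * ∑' l : ℤ, (((2 : ℝ≥0∞) ^ l) ^ (q - 1) *
              (if (2 : ℝ≥0∞) ^ l < F y then 1 else 0)))
            ≤ (4 : ℝ≥0∞) ^ q * N * (F y * (K * F y ^ (q - 1))) := by gcongr; exact hKs _
          _ = (4 : ℝ≥0∞) ^ q * N * K * (F y ^ (1 : ℝ) * F y ^ (q - 1)) := by
              rw [ENNReal.rpow_one]; ring
          _ = _ := by
              rw [← ENNReal.rpow_add_of_nonneg _ _ zero_le_one (by linarith), add_sub_cancel]
    _ = _ := lintegral_const_mul _ (hF.pow_const _)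

end CenteredMaximal

section Cubes

variable {n : ℕ} {Q : Set (Fin n → ℝ)}

lemma IsCube.measurableSet (hQ : IsCube Q) : MeasurableSet Q := by
  obtain ⟨c, h, -, rfl⟩ := hQ
  exact MeasurableSet.univ_pi fun _ => measurableSet_Ico

lemma IsCube.volume_ne_top (hQ : IsCube Q) : volume Q ≠ ∞ := by
  obtain ⟨c, h, -, rfl⟩ := hQ
  rw [Real.volume_pi_Ico]
  exact ENNReal.prod_ne_top fun _ _ => ofReal_ne_top

lemma IsCube.volume_ne_zero (hQ : IsCube Q) : volume Q ≠ 0 := by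
  obtain ⟨c, h, hh, rfl⟩ := hQ
  rw [Real.volume_pi_Ico]
  refine Finset.prod_ne_zero_iff.2 fun i _ => ?_
  simpa using hh

lemma IsCube.exists_dilate (hQ : IsCube Q) : ∃ Q', IsCube Q' ∧ volume Q' = 5 ^ n * volume Q ∧
    ∀ x ∈ Q, ∃ q : ℚ, 0 < q ∧ Q ⊆ Metric.ball x (q : ℝ) ∧ Metric.ball x (q : ℝ) ⊆ Q' := by
  obtain ⟨c, h, hh, rfl⟩ := hQ
  refine ⟨Set.univ.pi fun i => Set.Ico (c i - 2 * h) (c i - 2 * h + 5 * h),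
    ⟨fun i => c i - 2 * h, 5 * h, by positivity, rfl⟩, ?_, fun x hx => ?_⟩
  · simp only [Real.volume_pi_Ico, add_sub_cancel_left, Finset.prod_const, Finset.card_univ,
      Fintype.card_fin]
    rw [ENNReal.ofReal_mul (by norm_num), mul_pow]
    norm_num
  · obtain ⟨q, hq1, hq2⟩ := exists_rat_btwn (show h < 2 * h by linarith)
    have hq0 : (0 : ℝ) < q := hh.trans hq1
    refine ⟨q, by exact_mod_cast hq0, fun y hy => ?_, fun y hy => ?_⟩
    · rw [Metric.mem_ball, dist_pi_lt_iff hq0]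
      intro i
      have h1 := hx i (Set.mem_univ _)
      have h2 := hy i (Set.mem_univ _)
      simp only [Set.mem_Ico] at h1 h2
      rw [Real.dist_eq, abs_lt]
      constructor <;> linarith
    · rw [Metric.mem_ball, dist_pi_lt_iff hq0] at hy
      intro i _
      have h1 := hx i (Set.mem_univ _)
      have h2 := hy i
      rw [Real.dist_eq, abs_lt] at h2
      simp only [Set.mem_Ico] at h1 ⊢
      constructor <;> linarith

/-- Averages of `F` over a cube against the density `u` are controlled by the centred maximal
function with respect to `u dx`, at any point of the cube. -/
lemma setLIntegral_mul_le_centeredMax (hQ : MeasurableSet Q) {Q' : Set (Fin n → ℝ)}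
    (hQ' : MeasurableSet Q') {u F : (Fin n → ℝ) → ℝ≥0∞} (hu : Measurable u) (hF : Measurable F)
    (hu0 : ∀ x, u x ≠ 0) (hfin : ∫⁻ y in Q', u y ≠ ∞) {x : Fin n → ℝ} {q : ℚ} (hq : 0 < q)
    (h1 : Q ⊆ Metric.ball x (q : ℝ)) (h2 : Metric.ball x (q : ℝ) ⊆ Q') :
    ∫⁻ y in Q, u y * F y ≤
      (∫⁻ y in Q', u y) * centeredMax (volume.withDensity u) F x := by
  have hQ'μ : volume.withDensity u Q' = ∫⁻ y in Q', u y := withDensity_apply _ hQ'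
  have hq' : (0 : ℝ) < q := by exact_mod_cast hq
  have hb0 : volume.withDensity u (Metric.ball x (q : ℝ)) ≠ 0 := by
    rw [withDensity_apply _ Metric.isOpen_ball.measurableSet, Ne, lintegral_eq_zero_iff hu]
    intro h
    have h3 : ∀ᵐ y ∂(volume.restrict (Metric.ball x (q : ℝ))), False := by
      filter_upwards [h] with y hy using hu0 y hy
    rw [Filter.eventually_false_iff_eq_bot, ae_eq_bot, Measure.restrict_eq_zero] at h3
    exact (Metric.measure_ball_pos volume x hq').ne' h3
  have hbt : volume.withDensity u (Metric.ball x (q : ℝ)) ≠ ∞ :=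
    ((measure_mono h2).trans_lt (by rw [hQ'μ]; exact hfin.lt_top)).ne
  calc ∫⁻ y in Q, u y * F y
      = ∫⁻ y in Q, F y ∂(volume.withDensity u) := by
        rw [setLIntegral_withDensity_eq_setLIntegral_mul _ hu hF hQ]; rfl
    _ ≤ ∫⁻ y in Metric.ball x (q : ℝ), F y ∂(volume.withDensity u) :=
        lintegral_mono_set h1
    _ ≤ volume.withDensity u (Metric.ball x (q : ℝ)) * centeredMax (volume.withDensity u) F x :=
        setLIntegral_ball_le_centeredMax _ F x hq hb0 hbt
    _ ≤ _ := by
        rw [← hQ'μ]; exact mul_le_mul' (measure_mono h2) le_rfl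

end Cubes

/-- The exponential, as a map into `ℝ≥0∞`. -/
def eexp (t : ℝ) : ℝ≥0∞ := ENNReal.ofReal (Real.exp t)

lemma eexp_ne_zero (t : ℝ) : eexp t ≠ 0 := by simp [eexp, Real.exp_pos]

lemma eexp_ne_top (t : ℝ) : eexp t ≠ ∞ := ofReal_ne_top

lemma exists_eexp {x : ℝ≥0∞} (h0 : x ≠ 0) (ht : x ≠ ∞) : ∃ t, x = eexp t :=
  ⟨Real.log x.toReal, by rw [eexp, Real.exp_log (toReal_pos h0 ht), ofReal_toReal ht]⟩

lemma eexp_mul (a b : ℝ) : eexp a * eexp b = eexp (a + b) := by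
  rw [eexp, eexp, eexp, ← ENNReal.ofReal_mul (Real.exp_pos a).le, Real.exp_add]

lemma eexp_zero : eexp 0 = 1 := by simp [eexp]

lemma eexp_inv (a : ℝ) : (eexp a)⁻¹ = eexp (-a) := by
  rw [eexp, eexp, Real.exp_neg, ENNReal.ofReal_inv_of_pos (Real.exp_pos a)]

lemma eexp_rpow (a z : ℝ) : eexp a ^ z = eexp (a * z) := by
  rw [eexp, eexp, ENNReal.ofReal_rpow_of_pos (Real.exp_pos a), Real.exp_mul]

lemma eexp_injective : Function.Injective eexp := fun a b h => by
  have := (ENNReal.ofReal_eq_ofReal_iff (Real.exp_pos a).le (Real.exp_pos b).le).1 h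
  exact Real.exp_injective this

lemma prod_eexp {ι : Type*} (s : Finset ι) (f : ι → ℝ) :
    ∏ i ∈ s, eexp (f i) = eexp (∑ i ∈ s, f i) := by
  classical
  induction s using Finset.induction_on with
  | empty => simp [eexp_zero]
  | insert a s ha ih => rw [Finset.prod_insert ha, Finset.sum_insert ha, ih, eexp_mul]

/-- Exponents of the extrapolated bound: `R j = 1 / r_j`, `δ j = 1 / r_j - 1 / p_j`, `σ = 1 / s`,
`d = 1 / p - 1 / s`, and `γ` is the power of the weight constant. -/
structure Exponents (m : ℕ) where
  R : Fin m → ℝ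
  δ : Fin m → ℝ
  σ : ℝ
  d : ℝ
  γ : ℝ
  δ_pos : ∀ j, 0 < δ j
  δ_le : ∀ j, δ j ≤ R j
  R_le : ∀ j, R j ≤ γ * δ j
  d_pos : 0 < d
  σ_nonneg : 0 ≤ σ
  σ_le_one : σ ≤ 1
  one_sub_le : 1 - σ ≤ γ * d
  one_lt_γ : 1 < γ
  sum_eq : ∑ j, (R j - δ j) = σ + d

namespace Exponents

variable {m : ℕ} (a : Exponents m)

/-- The power of the averages against the weight `u` in the sparse bound. -/
def E : ℝ := a.σ + a.γ * a.d

/-- The excess of the power `γ` over the critical power of the `j`-th weight. -/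
def e (j : Fin m) : ℝ := a.γ * a.δ j - a.R j

lemma e_nonneg (j : Fin m) : 0 ≤ a.e j := sub_nonneg.2 (a.R_le j)

lemma R_pos (j : Fin m) : 0 < a.R j := (a.δ_pos j).trans_le (a.δ_le j)

lemma one_le_E : 1 ≤ a.E := by have := a.one_sub_le; unfold E; linarith

lemma E_pos : 0 < a.E := zero_lt_one.trans_le a.one_le_E

lemma lt_E : a.σ + a.d < a.E := by
  have := mul_pos (sub_pos.2 a.one_lt_γ) a.d_pos
  unfold E; linarith

/-- The reciprocal of the target exponent. -/
def ρ : ℝ := a.σ + a.d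

lemma ρ_pos : 0 < a.ρ := add_pos_of_nonneg_of_pos a.σ_nonneg a.d_pos

lemma σ_lt_ρ : a.σ < a.ρ := lt_add_of_pos_right _ a.d_pos

/-- The constant of the sparse bound on a single cube. -/
def K (n : ℕ) : ℝ≥0∞ :=
  2 ^ (a.E + ∑ j, a.e j) * ((5 ^ n : ℝ≥0∞) ^ (∑ j, a.δ j + a.d)) ^ a.γ

lemma K_ne_top (n : ℕ) : a.K n ≠ ∞ := by
  have h5 : (5 ^ n : ℝ≥0∞) ≠ ∞ := ENNReal.pow_ne_top (by norm_num)
  have h50 : (5 ^ n : ℝ≥0∞) ≠ 0 := pow_ne_zero _ (by norm_num)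
  refine ENNReal.mul_ne_top (rpow_ne_top_of_ne_zero (by norm_num) (by norm_num)) ?_
  exact rpow_ne_top_of_nonneg (zero_le_one.trans a.one_lt_γ.le) (rpow_ne_top_of_ne_zero h50 h5)

lemma prod_rpow_mul_le (n : ℕ) {q ε U W : ℝ≥0∞} {V : Fin m → ℝ≥0∞} (hq0 : q ≠ 0) (hqt : q ≠ ∞)
    (hV0 : ∀ j, V j ≠ 0) (hVt : ∀ j, V j ≠ ∞) (hU0 : U ≠ 0) (hUt : U ≠ ∞) (hε : q ≤ 2 * ε)
    (hW : (∏ j, ((5 ^ n * q)⁻¹ * V j) ^ a.δ j) * ((5 ^ n * q)⁻¹ * U) ^ a.d ≤ W) :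
    (∏ j, (q⁻¹ * V j) ^ a.R j) * (q⁻¹ * U) ^ (1 - a.σ) * q ≤
      a.K n * W ^ a.γ * U ^ (1 - a.E) *
        (ε ^ (a.E + ∑ j, a.e j) * ∏ j, V j ^ (-a.e j)) := by
  have hε' : 2⁻¹ * q ≤ ε := by
    calc 2⁻¹ * q ≤ 2⁻¹ * (2 * ε) := by gcongr
      _ = ε := by rw [← mul_assoc, ENNReal.inv_mul_cancel (by norm_num) (by norm_num), one_mul]
  have hEe : 0 ≤ a.E + ∑ j, a.e j :=
    add_nonneg a.E_pos.le (Finset.sum_nonneg fun j _ => a.e_nonneg j)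
  have hγ : 0 ≤ a.γ := zero_le_one.trans a.one_lt_γ.le
  have h5 : (5 ^ n : ℝ≥0∞) ≠ ∞ := ENNReal.pow_ne_top (by norm_num)
  have h50 : (5 ^ n : ℝ≥0∞) ≠ 0 := pow_ne_zero _ (by norm_num)
  calc (∏ j, (q⁻¹ * V j) ^ a.R j) * (q⁻¹ * U) ^ (1 - a.σ) * q
      = a.K n * ((∏ j, ((5 ^ n * q)⁻¹ * V j) ^ a.δ j) * ((5 ^ n * q)⁻¹ * U) ^ a.d) ^ a.γ *
          U ^ (1 - a.E) * ((2⁻¹ * q) ^ (a.E + ∑ j, a.e j) * ∏ j, V j ^ (-a.e j)) := by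
        have h2 : (2 : ℝ≥0∞) ≠ 0 := by norm_num
        have h2' : (2 : ℝ≥0∞) ≠ ∞ := by norm_num
        unfold K
        generalize (5 ^ n : ℝ≥0∞) = c at h5 h50 ⊢
        generalize (2 : ℝ≥0∞) = two at h2 h2' ⊢
        obtain ⟨c, rfl⟩ := exists_eexp h50 h5
        obtain ⟨t, rfl⟩ := exists_eexp h2 h2'
        obtain ⟨q, rfl⟩ := exists_eexp hq0 hqt
        obtain ⟨U, rfl⟩ := exists_eexp hU0 hUt
        choose V' hV' using fun j => exists_eexp (hV0 j) (hVt j)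
        simp only [hV', eexp_inv, eexp_mul, eexp_rpow, prod_eexp]
        congr 1
        simp only [e, E, add_mul, neg_mul, mul_neg, mul_sub, Finset.sum_add_distrib,
          Finset.sum_sub_distrib, Finset.sum_neg_distrib, ← Finset.mul_sum,
          neg_add_rev]
        have : ∑ j, V' j * (a.γ * a.δ j) = (∑ j, V' j * a.δ j) * a.γ := by
          rw [Finset.sum_mul]; exact Finset.sum_congr rfl fun j _ => by ring
        simp only [this]
        ring
    _ ≤ _ := by gcongr

end Exponents

/-- `Q'` is a cube comparable to `Q` such that `Q'` contains a ball centred at any given point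
of `Q` and containing `Q`. -/
def IsDilate {n : ℕ} (Q Q' : Set (Fin n → ℝ)) : Prop :=
  IsCube Q' ∧ volume Q' = 5 ^ n * volume Q ∧
    ∀ x ∈ Q, ∃ q : ℚ, 0 < q ∧ Q ⊆ Metric.ball x (q : ℝ) ∧ Metric.ball x (q : ℝ) ⊆ Q'

/-- The weights `v_j = w_j ^ (-1/δ_j)` and `u = (∏ w_j) ^ (1/d)`, with weight constant at most
`W`. -/
structure DualWeights {m : ℕ} (a : Exponents m) (n : ℕ) where
  v : Fin m → (Fin n → ℝ) → ℝ≥0∞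
  u : (Fin n → ℝ) → ℝ≥0∞
  W : ℝ≥0∞
  measurable_v : ∀ j, Measurable (v j)
  measurable_u : Measurable u
  v_ne_zero : ∀ j x, v j x ≠ 0
  v_ne_top : ∀ j x, v j x ≠ ∞
  u_ne_zero : ∀ x, u x ≠ 0
  u_ne_top : ∀ x, u x ≠ ∞
  prod_eq_one : ∀ x, (∏ j, v j x ^ a.δ j) * u x ^ a.d = 1
  setLIntegral_v_ne_top : ∀ j Q, IsCube Q → ∫⁻ x in Q, v j x ≠ ∞
  setLIntegral_u_ne_top : ∀ Q, IsCube Q → ∫⁻ x in Q, u x ≠ ∞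
  le_W : ∀ Q, IsCube Q → (∏ j, ((volume Q)⁻¹ * ∫⁻ x in Q, v j x) ^ a.δ j) *
    ((volume Q)⁻¹ * ∫⁻ x in Q, u x) ^ a.d ≤ W

lemma setLIntegral_ne_zero {n : ℕ} {Q : Set (Fin n → ℝ)} (hQ : volume Q ≠ 0)
    {u : (Fin n → ℝ) → ℝ≥0∞} (hu : Measurable u) (hu0 : ∀ x, u x ≠ 0) : ∫⁻ x in Q, u x ≠ 0 := by
  rw [Ne, lintegral_eq_zero_iff hu]
  intro h
  have h3 : ∀ᵐ y ∂(volume.restrict Q), False := by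
    filter_upwards [h] with y hy using hu0 y hy
  rw [Filter.eventually_false_iff_eq_bot, ae_eq_bot, Measure.restrict_eq_zero] at h3
  exact hQ h3

namespace DualWeights

variable {m n : ℕ} {a : Exponents m} (D : DualWeights a n)

/-- The function dominating the local contributions to the sparse form. -/
def N (P : Fin m → (Fin n → ℝ) → ℝ≥0∞) (x : Fin n → ℝ) : ℝ≥0∞ :=
  (∏ j, P j x ^ (1 / a.E)) * (∏ j, D.v j x ^ (-(a.e j / a.E))) * (D.u x)⁻¹

lemma measurable_N {P : Fin m → (Fin n → ℝ) → ℝ≥0∞} (hP : ∀ j, Measurable (P j)) :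
    Measurable (D.N P) :=
  ((Finset.measurable_prod _ fun j _ => (hP j).pow_const _).mul
    (Finset.measurable_prod _ fun j _ => (D.measurable_v j).pow_const _)).mul D.measurable_u.inv

lemma u_mul_N (P : Fin m → (Fin n → ℝ) → ℝ≥0∞) (x : Fin n → ℝ) :
    D.u x * D.N P x = (∏ j, P j x ^ (1 / a.E)) * ∏ j, D.v j x ^ (-(a.e j / a.E)) := by
  rw [N, mul_comm, mul_assoc, ENNReal.inv_mul_cancel (D.u_ne_zero x) (D.u_ne_top x), mul_one]

/-- A reverse bound for the integral of a product of negative powers, from Hölder's inequality. -/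
lemma rpow_volume_mul_le {A B : Set (Fin n → ℝ)} (hAB : A ⊆ B)
    (hB : ∀ j, ∫⁻ x in B, D.v j x ≠ ∞) (hB0 : ∀ j, ∫⁻ x in B, D.v j x ≠ 0) :
    volume A ^ (a.E + ∑ j, a.e j) * ∏ j, (∫⁻ x in B, D.v j x) ^ (-a.e j) ≤
      (∫⁻ x in A, ∏ j, D.v j x ^ (-(a.e j / a.E))) ^ a.E := by
  have hE := a.E_pos
  set H : (Fin n → ℝ) → ℝ≥0∞ := fun x => ∏ j, D.v j x ^ (-(a.e j / a.E)) with hH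
  have hHm : Measurable H := Finset.measurable_prod _ fun j _ => (D.measurable_v j).pow_const _
  have hs0 : 0 ≤ ∑ j, a.e j := Finset.sum_nonneg fun j _ => a.e_nonneg j
  set s : ℝ := a.E + ∑ j, a.e j with hs
  have hspos : 0 < s := add_pos_of_pos_of_nonneg hE hs0
  have key := ENNReal.lintegral_mul_prod_norm_pow_le (μ := volume.restrict A) Finset.univ
    (g := H) (f := D.v) hHm.aemeasurable (fun j _ => (D.measurable_v j).aemeasurable)
    (a.E / s) (p := fun j => a.e j / s)
    (by rw [← Finset.sum_div, ← add_div, div_self hspos.ne']) (by positivity)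
    (fun j _ => div_nonneg (a.e_nonneg j) hspos.le)
  have h1 : ∀ x, H x ^ (a.E / s) * ∏ j, D.v j x ^ (a.e j / s) = 1 := by
    intro x
    choose v' hv' using fun j => exists_eexp (D.v_ne_zero j x) (D.v_ne_top j x)
    simp only [hH, hv', eexp_rpow, prod_eexp, eexp_mul]
    rw [← eexp_zero, Finset.sum_mul, ← Finset.sum_add_distrib]
    congr 1
    refine Finset.sum_eq_zero fun j _ => ?_
    field_simp
    ring
  simp only [h1, lintegral_const, Measure.restrict_apply_univ, one_mul] at key
  have key2 : volume A ^ s ≤ (∫⁻ x in A, H x) ^ a.E * ∏ j, (∫⁻ x in B, D.v j x) ^ a.e j := by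
    calc volume A ^ s ≤ ((∫⁻ x in A, H x) ^ (a.E / s) *
          ∏ j, (∫⁻ x in A, D.v j x) ^ (a.e j / s)) ^ s := by gcongr
      _ = (∫⁻ x in A, H x) ^ a.E * ∏ j, (∫⁻ x in A, D.v j x) ^ a.e j := by
          rw [ENNReal.mul_rpow_of_nonneg _ _ hspos.le, ← ENNReal.prod_rpow_of_nonneg hspos.le]
          simp only [← ENNReal.rpow_mul, div_mul_cancel₀ _ hspos.ne']
      _ ≤ _ := by
          gcongr with j _
          exact a.e_nonneg j
  calc volume A ^ s * ∏ j, (∫⁻ x in B, D.v j x) ^ (-a.e j)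
      ≤ ((∫⁻ x in A, H x) ^ a.E * ∏ j, (∫⁻ x in B, D.v j x) ^ a.e j) *
          ∏ j, (∫⁻ x in B, D.v j x) ^ (-a.e j) := by gcongr
    _ = (∫⁻ x in A, H x) ^ a.E := by
        rw [mul_assoc, ← Finset.prod_mul_distrib]
        rw [Finset.prod_eq_one, mul_one]
        intro j _
        rw [← ENNReal.rpow_add _ _ (hB0 j) (hB j), add_neg_cancel, ENNReal.rpow_zero]

/-- The contribution of a single cube to the sparse form. -/
lemma prod_mul_le {Q Q' A : Set (Fin n → ℝ)} (hQ : IsCube Q) (hQ' : IsDilate Q Q')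
    (hA : MeasurableSet A) (hAQ : A ⊆ Q) (hAQ' : A ⊆ Q') (hQA : volume Q ≤ 2 * volume A)
    {P : Fin m → (Fin n → ℝ) → ℝ≥0∞} {F : Fin m → ℝ≥0∞}
    (hF : ∀ j, ∀ x ∈ Q, F j ≤ ((volume Q)⁻¹ * ∫⁻ y in Q', D.v j y) ^ a.R j * P j x) :
    (∏ j, F j) * ((volume Q)⁻¹ * ∫⁻ y in Q', D.u y) ^ (1 - a.σ) * volume Q ≤
      a.K n * D.W ^ a.γ * (((∫⁻ y in Q', D.u y)⁻¹ * ∫⁻ y in A, D.u y * D.N P y) ^ (a.E - 1) *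
        ∫⁻ y in A, D.u y * D.N P y) := by
  have hE := a.E_pos
  set q := volume Q with hq
  have hq0 : q ≠ 0 := hQ.volume_ne_zero
  have hqt : q ≠ ∞ := hQ.volume_ne_top
  set V : Fin m → ℝ≥0∞ := fun j => ∫⁻ y in Q', D.v j y with hV
  have hV0 : ∀ j, V j ≠ 0 := fun j =>
    setLIntegral_ne_zero hQ'.1.volume_ne_zero (D.measurable_v j) (D.v_ne_zero j)
  have hVt : ∀ j, V j ≠ ∞ := fun j => D.setLIntegral_v_ne_top j _ hQ'.1
  set U := ∫⁻ y in Q', D.u y with hU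
  have hU0 : U ≠ 0 := setLIntegral_ne_zero hQ'.1.volume_ne_zero D.measurable_u D.u_ne_zero
  have hUt : U ≠ ∞ := D.setLIntegral_u_ne_top _ hQ'.1
  set I := ∫⁻ y in A, D.u y * D.N P y with hI
  have hb0 : ∀ j, (q⁻¹ * V j) ^ a.R j ≠ 0 := fun j => by
    obtain ⟨q', hq'⟩ := exists_eexp hq0 hqt
    obtain ⟨V', hV'⟩ := exists_eexp (hV0 j) (hVt j)
    rw [hq', hV', eexp_inv, eexp_mul, eexp_rpow]
    exact eexp_ne_zero _
  have hbt : ∀ j, (q⁻¹ * V j) ^ a.R j ≠ ∞ := fun j =>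
    rpow_ne_top_of_nonneg (a.R_pos j).le (mul_ne_top (inv_ne_top.2 hq0) (hVt j))
  set b : Fin m → ℝ≥0∞ := fun j => F j * ((q⁻¹ * V j) ^ a.R j)⁻¹ with hb
  have hFb : ∀ j, F j = b j * (q⁻¹ * V j) ^ a.R j := fun j => by
    rw [hb, mul_assoc, ENNReal.inv_mul_cancel (hb0 j) (hbt j), mul_one]
  have hbP : ∀ j, ∀ x ∈ Q, b j ≤ P j x := fun j x hx => by
    calc b j ≤ ((q⁻¹ * V j) ^ a.R j * P j x) * ((q⁻¹ * V j) ^ a.R j)⁻¹ :=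
          mul_le_mul' (hF j x hx) le_rfl
      _ = P j x := by
          rw [mul_comm, ← mul_assoc, ENNReal.inv_mul_cancel (hb0 j) (hbt j), one_mul]
  have hW : (∏ j, ((5 ^ n * q)⁻¹ * V j) ^ a.δ j) * ((5 ^ n * q)⁻¹ * U) ^ a.d ≤ D.W := by
    have := D.le_W Q' hQ'.1
    rwa [hQ'.2.1] at this
  have h1 : (∏ j, b j) * (∫⁻ x in A, ∏ j, D.v j x ^ (-(a.e j / a.E))) ^ a.E ≤ I ^ a.E := by
    have hmeas : Measurable fun x => ∏ j, D.v j x ^ (-(a.e j / a.E)) :=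
      Finset.measurable_prod _ fun j _ => (D.measurable_v j).pow_const _
    calc (∏ j, b j) * (∫⁻ x in A, ∏ j, D.v j x ^ (-(a.e j / a.E))) ^ a.E
        = ((∏ j, b j ^ (1 / a.E)) * ∫⁻ x in A, ∏ j, D.v j x ^ (-(a.e j / a.E))) ^ a.E := by
          rw [ENNReal.mul_rpow_of_nonneg _ _ hE.le, ← ENNReal.prod_rpow_of_nonneg hE.le]
          simp only [← ENNReal.rpow_mul, one_div, inv_mul_cancel₀ hE.ne', ENNReal.rpow_one]
      _ ≤ I ^ a.E := by
          gcongr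
          rw [hI, ← lintegral_const_mul _ hmeas]
          refine setLIntegral_mono' hA fun x hx => ?_
          rw [u_mul_N]
          gcongr with j _
          exact hbP j x (hAQ hx)
  calc (∏ j, F j) * (q⁻¹ * U) ^ (1 - a.σ) * q
      = (∏ j, b j) * ((∏ j, (q⁻¹ * V j) ^ a.R j) * (q⁻¹ * U) ^ (1 - a.σ) * q) := by
        simp only [hFb, Finset.prod_mul_distrib]
        ring
    _ ≤ (∏ j, b j) * (a.K n * D.W ^ a.γ * U ^ (1 - a.E) *
        (volume A ^ (a.E + ∑ j, a.e j) * ∏ j, V j ^ (-a.e j))) := by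
        exact mul_le_mul' le_rfl (a.prod_rpow_mul_le n hq0 hqt hV0 hVt hU0 hUt hQA hW)
    _ ≤ (∏ j, b j) * (a.K n * D.W ^ a.γ * U ^ (1 - a.E) *
        (∫⁻ x in A, ∏ j, D.v j x ^ (-(a.e j / a.E))) ^ a.E) := by
        gcongr
        exact D.rpow_volume_mul_le hAQ' hVt hV0
    _ = a.K n * D.W ^ a.γ * U ^ (1 - a.E) *
        ((∏ j, b j) * (∫⁻ x in A, ∏ j, D.v j x ^ (-(a.e j / a.E))) ^ a.E) := by ring
    _ ≤ a.K n * D.W ^ a.γ * U ^ (1 - a.E) * I ^ a.E := by gcongr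
    _ = a.K n * D.W ^ a.γ * ((U⁻¹ * I) ^ (a.E - 1) * I) := by
        have hE1 : 0 ≤ a.E - 1 := sub_nonneg.2 a.one_le_E
        have h2 : I ^ a.E = I ^ (a.E - 1) * I := by
          conv_lhs => rw [← sub_add_cancel a.E 1, ENNReal.rpow_add_of_nonneg _ _ hE1 zero_le_one,
            ENNReal.rpow_one]
        rw [ENNReal.mul_rpow_of_nonneg _ _ hE1, h2, ENNReal.inv_rpow, ← ENNReal.rpow_neg, neg_sub]
        ring

end DualWeights

lemma IsDilate.subset {n : ℕ} {Q Q' : Set (Fin n → ℝ)} (h : IsDilate Q Q') : Q ⊆ Q' := by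
  intro x hx
  obtain ⟨q, -, h1, h2⟩ := h.2.2 x hx
  exact h2 (h1 hx)

lemma tsum_setLIntegral_le {n : ℕ} (S : SparseFamily n) (G : (Fin n → ℝ) → ℝ≥0∞) :
    ∑' Q : S.cubes, ∫⁻ x in S.E Q.1, G x ≤ ∫⁻ x, G x := by
  rw [ENNReal.tsum_eq_iSup_sum]
  refine iSup_le fun s => ?_
  rw [← lintegral_biUnion_finset (fun Q _ Q' _ h => S.E_disj _ Q.2 _ Q'.2 (Subtype.coe_ne_coe.2 h))
    (fun Q _ => S.E_meas _ Q.2)]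
  exact setLIntegral_le_lintegral _ _

lemma sparseForm_snoc {n m : ℕ} (R : Fin m → ℝ) (τ : ℝ) (S : SparseFamily n)
    (f : Fin m → (Fin n → ℝ) → ℝ) (g : (Fin n → ℝ) → ℝ) :
    sparseForm (n := n) (m := m + 1) (Fin.snoc R τ) S (Fin.snoc f g) =
      ∑' Q : S.cubes, (∏ j, avg (R j) (f j) Q.1) * avg τ g Q.1 * volume Q.1 := by
  simp only [sparseForm, Fin.prod_univ_castSucc, Fin.snoc_castSucc, Fin.snoc_last]

namespace DualWeights

variable {m n : ℕ} {a : Exponents m} (D : DualWeights a n)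

lemma sparseForm_le (S : SparseFamily n) {f : Fin m → (Fin n → ℝ) → ℝ} {g : (Fin n → ℝ) → ℝ}
    {P : Fin m → (Fin n → ℝ) → ℝ≥0∞} {Φ : (Fin n → ℝ) → ℝ≥0∞}
    (hF : ∀ j Q Q', IsCube Q → IsDilate Q Q' → ∀ x ∈ Q, avg (a.R j) (f j) Q ≤
      ((volume Q)⁻¹ * ∫⁻ y in Q', D.v j y) ^ a.R j * P j x)
    (hg : ∀ Q Q' A, IsCube Q → IsDilate Q Q' → MeasurableSet A → A ⊆ Q → ∀ x ∈ Q,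
      avg (1 - a.σ) g Q * ((∫⁻ y in Q', D.u y)⁻¹ * ∫⁻ y in A, D.u y * D.N P y) ^ (a.E - 1) ≤
        ((volume Q)⁻¹ * ∫⁻ y in Q', D.u y) ^ (1 - a.σ) * Φ x) :
    sparseForm (n := n) (m := m + 1) (Fin.snoc a.R (1 - a.σ)) S (Fin.snoc f g) ≤
      a.K n * D.W ^ a.γ * ∫⁻ x, D.u x * D.N P x * Φ x := by
  rw [sparseForm_snoc]
  calc ∑' Q : S.cubes, (∏ j, avg (a.R j) (f j) Q.1) * avg (1 - a.σ) g Q.1 * volume Q.1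
      ≤ ∑' Q : S.cubes, a.K n * D.W ^ a.γ * ∫⁻ x in S.E Q.1, D.u x * D.N P x * Φ x := by
        refine ENNReal.tsum_le_tsum fun ⟨Q, hQS⟩ => ?_
        have hQ := S.isCube Q hQS
        have hA := S.E_meas Q hQS
        have hAQ := S.E_subset Q hQS
        obtain ⟨Q', hQ'⟩ : ∃ Q', IsDilate Q Q' := hQ.exists_dilate
        have h1 := D.prod_mul_le hQ hQ' hA hAQ (hAQ.trans hQ'.subset) (S.density Q hQS)
          (P := P) (F := fun j => avg (a.R j) (f j) Q) fun j x hx => hF j Q Q' hQ hQ' x hx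
        have h2 := hg Q Q' _ hQ hQ' hA hAQ
        set B := ((volume Q)⁻¹ * ∫⁻ y in Q', D.u y) ^ (1 - a.σ) with hB
        set I := ∫⁻ y in S.E Q, D.u y * D.N P y with hI
        set ν := ((∫⁻ y in Q', D.u y)⁻¹ * I) ^ (a.E - 1) with hν
        have hq0 : (volume Q)⁻¹ * ∫⁻ y in Q', D.u y ≠ 0 :=
          mul_ne_zero (ENNReal.inv_ne_zero.2 hQ.volume_ne_top)
            (setLIntegral_ne_zero hQ'.1.volume_ne_zero D.measurable_u D.u_ne_zero)
        have hqt : (volume Q)⁻¹ * ∫⁻ y in Q', D.u y ≠ ∞ :=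
          mul_ne_top (inv_ne_top.2 hQ.volume_ne_zero) (D.setLIntegral_u_ne_top _ hQ'.1)
        have hB0 : B ≠ 0 := by
          obtain ⟨t, ht⟩ := exists_eexp hq0 hqt
          rw [hB, ht, eexp_rpow]
          exact eexp_ne_zero _
        have hBt : B ≠ ∞ := rpow_ne_top_of_nonneg (sub_nonneg.2 a.σ_le_one) hqt
        set β := avg (1 - a.σ) g Q * B⁻¹ with hβ
        have hβB : avg (1 - a.σ) g Q = β * B := by
          rw [hβ, mul_assoc, ENNReal.inv_mul_cancel hB0 hBt, mul_one]
        have h3 : ∀ x ∈ Q, β * ν ≤ Φ x := fun x hx => by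
          calc β * ν = avg (1 - a.σ) g Q * ν * B⁻¹ := by rw [hβ]; ring
            _ ≤ B * Φ x * B⁻¹ := mul_le_mul' (h2 x hx) le_rfl
            _ = Φ x := by
              rw [mul_comm, ← mul_assoc, ENNReal.inv_mul_cancel hB0 hBt, one_mul]
        calc (∏ j, avg (a.R j) (f j) Q) * avg (1 - a.σ) g Q * volume Q
            = β * ((∏ j, avg (a.R j) (f j) Q) * B * volume Q) := by rw [hβB]; ring
          _ ≤ β * (a.K n * D.W ^ a.γ * (ν * I)) := mul_le_mul' le_rfl h1
          _ = a.K n * D.W ^ a.γ * ((β * ν) * I) := by ring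
          _ ≤ a.K n * D.W ^ a.γ * ∫⁻ x in S.E Q, D.u x * D.N P x * Φ x := by
            refine mul_le_mul' le_rfl ((lintegral_const_mul_le _ _).trans ?_)
            refine setLIntegral_mono' hA fun x hx => ?_
            rw [mul_comm]
            exact mul_le_mul' le_rfl (h3 x (hAQ hx))
    _ ≤ _ := by
        rw [ENNReal.tsum_mul_left]
        exact mul_le_mul' le_rfl (tsum_setLIntegral_le S _)

end DualWeights

/-- An average over a cube is controlled at any of its points by a maximal function with respect
to a weight. -/
lemma avg_le_rpow_mul {n : ℕ} {τ : ℝ} (hτ : 0 < τ) {f : (Fin n → ℝ) → ℝ} (hf : Measurable f)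
    {u : (Fin n → ℝ) → ℝ≥0∞} (hu : Measurable u) (hu0 : ∀ x, u x ≠ 0) (hut : ∀ x, u x ≠ ∞)
    {Q Q' : Set (Fin n → ℝ)} (hQ : IsCube Q) (hQ' : IsDilate Q Q')
    (hfin : ∫⁻ y in Q', u y ≠ ∞) {x : Fin n → ℝ} (hx : x ∈ Q) :
    avg τ f Q ≤ ((volume Q)⁻¹ * ∫⁻ y in Q', u y) ^ τ *
      centeredMax (volume.withDensity u)
        (fun y => ENNReal.ofReal |f y| ^ (1 / τ) * (u y)⁻¹) x ^ τ := by
  obtain ⟨q, hq, h1, h2⟩ := hQ'.2.2 x hx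
  have hF : Measurable fun y => ENNReal.ofReal |f y| ^ (1 / τ) * (u y)⁻¹ :=
    ((hf.abs.ennreal_ofReal).pow_const _).mul hu.inv
  rw [avg, if_neg hτ.ne', ← ENNReal.mul_rpow_of_nonneg _ _ hτ.le]
  gcongr ?_ ^ τ
  rw [mul_assoc]
  refine mul_le_mul' le_rfl ?_
  refine le_trans (le_of_eq ?_) (setLIntegral_mul_le_centeredMax hQ.measurableSet
    hQ'.1.measurableSet hu hF hu0 hfin hq h1 h2)
  refine lintegral_congr fun y => ?_
  rw [mul_comm, mul_assoc, ENNReal.inv_mul_cancel (hu0 y) (hut y), mul_one]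

lemma inv_mul_setLIntegral_le_centeredMax {n : ℕ} {u F : (Fin n → ℝ) → ℝ≥0∞}
    (hu : Measurable u) (hF : Measurable F) (hu0 : ∀ x, u x ≠ 0) {Q Q' A : Set (Fin n → ℝ)}
    (hQ' : IsDilate Q Q') (hA : MeasurableSet A) (hAQ : A ⊆ Q)
    (hfin : ∫⁻ y in Q', u y ≠ ∞) {x : Fin n → ℝ} (hx : x ∈ Q) :
    (∫⁻ y in Q', u y)⁻¹ * ∫⁻ y in A, u y * F y ≤ centeredMax (volume.withDensity u) F x := by
  obtain ⟨q, hq, h1, h2⟩ := hQ'.2.2 x hx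
  calc _ ≤ (∫⁻ y in Q', u y)⁻¹ * ((∫⁻ y in Q', u y) * centeredMax (volume.withDensity u) F x) :=
        mul_le_mul' le_rfl (setLIntegral_mul_le_centeredMax hA hQ'.1.measurableSet hu hF hu0
          hfin hq (hAQ.trans h1) h2)
    _ = _ := by
        rw [← mul_assoc, ENNReal.inv_mul_cancel
          (setLIntegral_ne_zero hQ'.1.volume_ne_zero hu hu0) hfin, one_mul]

/-- The `L^{1/ρ}` norm of a nonnegative function; `ρ = 0` encodes the essential supremum. -/
def lnorm {n : ℕ} (ρ : ℝ) (F : (Fin n → ℝ) → ℝ≥0∞) : ℝ≥0∞ :=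
  if ρ = 0 then essSup F volume else (∫⁻ x, F x ^ (1 / ρ)) ^ ρ

/-- The maximal function of `F ^ (1/R) / u` with respect to `u dx`, raised to the power `R`. -/
def weightedMax {n : ℕ} (R : ℝ) (u F : (Fin n → ℝ) → ℝ≥0∞) (x : Fin n → ℝ) : ℝ≥0∞ :=
  centeredMax (volume.withDensity u) (fun y => F y ^ (1 / R) * (u y)⁻¹) x ^ R

lemma measurable_weightedMax {n : ℕ} (R : ℝ) {u F : (Fin n → ℝ) → ℝ≥0∞} (hu : Measurable u)
    (hF : Measurable F) : Measurable (weightedMax R u F) :=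
  (measurable_centeredMax _ ((hF.pow_const _).mul hu.inv)).pow_const _

lemma exists_lintegral_mul_centeredMax_rpow_le (n : ℕ) {q : ℝ} (hq : 1 < q) :
    ∃ K : ℝ≥0∞, K ≠ ∞ ∧ ∀ u F : (Fin n → ℝ) → ℝ≥0∞, Measurable u → Measurable F →
      ∫⁻ x, u x * centeredMax (volume.withDensity u) F x ^ q ≤ K * ∫⁻ x, u x * F x ^ q := by
  obtain ⟨K, hK, h⟩ := exists_lintegral_centeredMax_rpow_le (Fin n → ℝ) hq
  refine ⟨K, hK, fun u F hu hF => ?_⟩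
  have := h (volume.withDensity u) F hF
  rwa [lintegral_withDensity_eq_lintegral_mul _ hu ((measurable_centeredMax _ hF).pow_const _),
    lintegral_withDensity_eq_lintegral_mul _ hu (hF.pow_const _)] at this

lemma exists_lintegral_weightedMax_le (n : ℕ) {R δ : ℝ} (hδ : 0 < δ) (hδR : δ < R) :
    ∃ K : ℝ≥0∞, K ≠ ∞ ∧ ∀ u F : (Fin n → ℝ) → ℝ≥0∞, Measurable u → Measurable F →
      (∀ x, u x ≠ 0) → (∀ x, u x ≠ ∞) →
      ∫⁻ x, u x * weightedMax R u F x ^ (1 / (R - δ)) ≤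
        K * ∫⁻ x, (F x * u x ^ (-δ)) ^ (1 / (R - δ)) := by
  have hR : 0 < R := hδ.trans hδR
  have hρ : 0 < R - δ := sub_pos.2 hδR
  obtain ⟨K, hK, h⟩ := exists_lintegral_mul_centeredMax_rpow_le n (q := R * (1 / (R - δ)))
    (by rw [mul_one_div, one_lt_div hρ]; linarith)
  refine ⟨K, hK, fun u F hu hF hu0 hut => ?_⟩
  have := h u (fun y => F y ^ (1 / R) * (u y)⁻¹) hu ((hF.pow_const _).mul hu.inv)
  simp only [weightedMax, ← ENNReal.rpow_mul]
  refine this.trans (le_of_eq ?_)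
  congr 1
  refine lintegral_congr fun x => ?_
  rw [ENNReal.mul_rpow_of_nonneg _ _ (by positivity), ENNReal.mul_rpow_of_nonneg _ _ (by positivity),
    ← ENNReal.rpow_mul, mul_left_comm]
  congr 1
  · congr 1
    field_simp
  · obtain ⟨t, ht⟩ := exists_eexp (hu0 x) (hut x)
    rw [ht, eexp_inv, eexp_rpow, eexp_rpow, eexp_rpow, eexp_mul]
    congr 1
    field_simp
    ring

lemma weightedMax_le_essSup {n : ℕ} {R : ℝ} (hR : 0 < R) (u F : (Fin n → ℝ) → ℝ≥0∞)
    (x : Fin n → ℝ) :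
    weightedMax R u F x ≤ essSup (fun y => F y * u y ^ (-R)) volume := by
  set B := essSup (fun y => F y * u y ^ (-R)) volume with hB
  have h1 : centeredMax (volume.withDensity u) (fun y => F y ^ (1 / R) * (u y)⁻¹) x ≤
      B ^ (1 / R) := by
    refine centeredMax_le_of_ae_le _ ((withDensity_absolutelyContinuous _ _).ae_le ?_) x
    filter_upwards [ENNReal.ae_le_essSup fun y => F y * u y ^ (-R)] with y hy
    calc F y ^ (1 / R) * (u y)⁻¹ = (F y * u y ^ (-R)) ^ (1 / R) := by
          rw [ENNReal.mul_rpow_of_nonneg _ _ (by positivity), ← ENNReal.rpow_mul, mul_one_div,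
            neg_div, div_self hR.ne', ENNReal.rpow_neg_one]
      _ ≤ B ^ (1 / R) := by gcongr
  calc weightedMax R u F x ≤ (B ^ (1 / R)) ^ R := by unfold weightedMax; gcongr
    _ = B := by rw [← ENNReal.rpow_mul, one_div_mul_cancel hR.ne', ENNReal.rpow_one]

namespace DualWeights

variable {m n : ℕ} {a : Exponents m} (D : DualWeights a n)

lemma u_mul_N_rpow (P : Fin m → (Fin n → ℝ) → ℝ≥0∞) (x : Fin n → ℝ) :
    D.u x * D.N P x ^ (a.E / a.ρ) =
      ∏ j, (P j x ^ (1 / a.ρ) * D.v j x ^ ((a.R j - a.δ j) / a.ρ)) := by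
  have hE := a.E_pos
  have hρ := a.ρ_pos
  rw [N, mul_assoc, ENNReal.mul_rpow_of_nonneg _ _ (by positivity), Finset.prod_mul_distrib,
    mul_left_comm]
  congr 1
  · rw [← ENNReal.prod_rpow_of_nonneg (by positivity)]
    simp only [← ENNReal.rpow_mul]
    congr! 2
    field_simp
  · have h1 := D.prod_eq_one x
    obtain ⟨t, ht⟩ := exists_eexp (D.u_ne_zero x) (D.u_ne_top x)
    choose s hs using fun j => exists_eexp (D.v_ne_zero j x) (D.v_ne_top j x)
    simp only [ht, hs, eexp_inv, eexp_mul, eexp_rpow, prod_eexp] at h1 ⊢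
    rw [← eexp_zero] at h1
    have h2 := eexp_injective h1
    congr 1
    have h3 : ∑ j, s j * ((a.R j - a.δ j) / a.ρ) =
        (∑ j, s j * a.R j) / a.ρ - (∑ j, s j * a.δ j) / a.ρ := by
      rw [Finset.sum_div, Finset.sum_div, ← Finset.sum_sub_distrib]
      exact Finset.sum_congr rfl fun j _ => by ring
    have h4 : ∑ j, s j * -(a.e j / a.E) =
        (∑ j, s j * a.R j) / a.E - a.γ * (∑ j, s j * a.δ j) / a.E := by
      rw [Finset.mul_sum, Finset.sum_div, Finset.sum_div, ← Finset.sum_sub_distrib]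
      exact Finset.sum_congr rfl fun j _ => by rw [Exponents.e]; ring
    have h5 : ∑ j, s j * a.δ j = - (t * a.d) := by linarith
    rw [h3, h4, h5]
    field_simp
    rw [Exponents.ρ, Exponents.E]
    ring

/-- The maximal functions of the entries of a tuple with respect to the dual weights. -/
def maxFn (F : Fin m → (Fin n → ℝ) → ℝ≥0∞) (j : Fin m) : (Fin n → ℝ) → ℝ≥0∞ :=
  weightedMax (a.R j) (D.v j) (F j)

end DualWeights

lemma exists_lintegral_N_maxFn_le (n : ℕ) {m : ℕ} (a : Exponents m) :
    ∃ C : ℝ≥0∞, C ≠ ∞ ∧ ∀ (D : DualWeights a n) (F : Fin m → (Fin n → ℝ) → ℝ≥0∞),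
      (∀ j, Measurable (F j)) →
      ∫⁻ x, D.u x * D.N (D.maxFn F) x ^ (a.E / a.ρ) ≤
        C * (∏ j, lnorm (a.R j - a.δ j) fun x => F j x * D.v j x ^ (-a.δ j)) ^ (1 / a.ρ) := by
  have hρ := a.ρ_pos
  have hex : ∀ j, ∃ K : ℝ≥0∞, K ≠ ∞ ∧ ∀ (D : DualWeights a n) (F : (Fin n → ℝ) → ℝ≥0∞),
      Measurable F → 0 < a.R j - a.δ j →
      ∫⁻ x, D.v j x * weightedMax (a.R j) (D.v j) F x ^ (1 / (a.R j - a.δ j)) ≤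
        K * ∫⁻ x, (F x * D.v j x ^ (-a.δ j)) ^ (1 / (a.R j - a.δ j)) := by
    intro j
    by_cases h : a.δ j < a.R j
    · obtain ⟨K, hK, hKs⟩ := exists_lintegral_weightedMax_le n (a.δ_pos j) h
      exact ⟨K, hK, fun D F hF _ => hKs _ F (D.measurable_v j) hF (D.v_ne_zero j) (D.v_ne_top j)⟩
    · exact ⟨0, by simp, fun D F hF h' => absurd (sub_pos.1 h') h⟩
  choose K hK hKs using hex
  refine ⟨∏ j, K j ^ ((a.R j - a.δ j) / a.ρ), ENNReal.prod_ne_top fun j _ =>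
    rpow_ne_top_of_nonneg (div_nonneg (sub_nonneg.2 (a.δ_le j)) hρ.le) (hK j),
    fun D F hF => ?_⟩
  set A : Fin m → ℝ≥0∞ := fun j => lnorm (a.R j - a.δ j) fun x => F j x * D.v j x ^ (-a.δ j)
  set c : Fin m → ℝ≥0∞ := fun j => if a.R j - a.δ j = 0 then A j ^ (1 / a.ρ) else 1 with hc
  set G : Fin m → (Fin n → ℝ) → ℝ≥0∞ := fun j x =>
    D.v j x * D.maxFn F j x ^ (1 / (a.R j - a.δ j)) with hG
  have hPm : ∀ j, Measurable (D.maxFn F j) := fun j =>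
    measurable_weightedMax _ (D.measurable_v j) (hF j)
  have hGm : ∀ j, Measurable (G j) := fun j => (D.measurable_v j).mul ((hPm j).pow_const _)
  have hpt : ∀ x, D.u x * D.N (D.maxFn F) x ^ (a.E / a.ρ) ≤
      (∏ j, c j) * ∏ j, G j x ^ ((a.R j - a.δ j) / a.ρ) := by
    intro x
    rw [D.u_mul_N_rpow, ← Finset.prod_mul_distrib]
    refine Finset.prod_le_prod' fun j _ => ?_
    by_cases h : a.R j - a.δ j = 0
    · have hδ : a.δ j = a.R j := by linarith
      simp only [hc, h, if_true, zero_div, ENNReal.rpow_zero, mul_one]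
      gcongr
      simp only [A, lnorm, h, if_true]
      rw [hδ]
      exact weightedMax_le_essSup (a.R_pos j) (D.v j) (F j) x
    · have h' : 0 < a.R j - a.δ j := lt_of_le_of_ne (sub_nonneg.2 (a.δ_le j)) (Ne.symm h)
      simp only [hc, h, if_false, one_mul, hG]
      rw [ENNReal.mul_rpow_of_nonneg _ _ (by positivity), ← ENNReal.rpow_mul, mul_comm]
      refine le_of_eq ?_
      congr 2
      field_simp
  have hGle : ∀ j, c j * (∫⁻ x, G j x) ^ ((a.R j - a.δ j) / a.ρ) ≤
      K j ^ ((a.R j - a.δ j) / a.ρ) * A j ^ (1 / a.ρ) := by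
    intro j
    by_cases h : a.R j - a.δ j = 0
    · simp [hc, h]
    · have h' : 0 < a.R j - a.δ j := lt_of_le_of_ne (sub_nonneg.2 (a.δ_le j)) (Ne.symm h)
      simp only [hc, h, if_false, one_mul]
      calc (∫⁻ x, G j x) ^ ((a.R j - a.δ j) / a.ρ)
          ≤ (K j * ∫⁻ x, (F j x * D.v j x ^ (-a.δ j)) ^ (1 / (a.R j - a.δ j))) ^
            ((a.R j - a.δ j) / a.ρ) := by
            gcongr
            exact hKs j D (F j) (hF j) h'
        _ = _ := by
            rw [ENNReal.mul_rpow_of_nonneg _ _ (by positivity)]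
            simp only [A, lnorm, h, if_false]
            rw [← ENNReal.rpow_mul _ (a.R j - a.δ j), mul_one_div]
  have hsum : ∑ j, (a.R j - a.δ j) / a.ρ = 1 := by
    rw [← Finset.sum_div, a.sum_eq]
    exact div_self hρ.ne'
  calc ∫⁻ x, D.u x * D.N (D.maxFn F) x ^ (a.E / a.ρ)
      ≤ ∫⁻ x, (∏ j, c j) * ∏ j, G j x ^ ((a.R j - a.δ j) / a.ρ) := lintegral_mono hpt
    _ = (∏ j, c j) * ∫⁻ x, ∏ j, G j x ^ ((a.R j - a.δ j) / a.ρ) :=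
        lintegral_const_mul _ (Finset.measurable_prod _ fun j _ => (hGm j).pow_const _)
    _ ≤ (∏ j, c j) * ∏ j, (∫⁻ x, G j x) ^ ((a.R j - a.δ j) / a.ρ) := by
        refine mul_le_mul' le_rfl (ENNReal.lintegral_prod_norm_pow_le Finset.univ
          (fun j _ => (hGm j).aemeasurable) hsum
          fun j _ => div_nonneg (sub_nonneg.2 (a.δ_le j)) hρ.le)
    _ ≤ ∏ j, (K j ^ ((a.R j - a.δ j) / a.ρ) * A j ^ (1 / a.ρ)) := by
        rw [← Finset.prod_mul_distrib]
        exact Finset.prod_le_prod' fun j _ => hGle j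
    _ = _ := by
        rw [Finset.prod_mul_distrib, ENNReal.prod_rpow_of_nonneg (by positivity)]

lemma lintegral_le_of_forall_setLIntegral_le {n : ℕ} {b F : (Fin n → ℝ) → ℝ≥0∞}
    (hb : ∀ x, b x ≠ ∞) {c : ℝ≥0∞}
    (h : ∀ k : ℕ, ∫⁻ x in {x | ‖x‖ₑ + b x ≤ k}, F x ≤ c) : ∫⁻ x, F x ≤ c := by
  have hU : ⋃ k : ℕ, {x | ‖x‖ₑ + b x ≤ k} = Set.univ := by
    refine Set.eq_univ_of_forall fun x => Set.mem_iUnion.2 ?_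
    obtain ⟨k, hk⟩ := ENNReal.exists_nat_gt (add_ne_top.2 ⟨enorm_ne_top (x := x), hb x⟩)
    exact ⟨k, hk.le⟩
  have hmono : Monotone fun k : ℕ => {x : Fin n → ℝ | ‖x‖ₑ + b x ≤ k} :=
    fun i j hij x hx => le_trans (α := ℝ≥0∞) hx (by exact_mod_cast hij)
  rw [← setLIntegral_univ, ← hU, setLIntegral_iUnion_of_directed _ hmono.directed_le]
  exact iSup_le h

lemma bddCompSupp_toReal {n : ℕ} {G : (Fin n → ℝ) → ℝ≥0∞} (hG : Measurable G) {M : ℝ≥0∞}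
    (hM : M ≠ ∞) (hGM : ∀ x, G x ≤ M) {k : ℕ} (hk : ∀ x, ¬ ‖x‖ₑ ≤ k → G x = 0) :
    BddCompSupp (fun x => (G x).toReal) := by
  refine ⟨hG.ennreal_toReal, ⟨M.toReal, fun x => ?_⟩, ?_⟩
  · rw [abs_of_nonneg toReal_nonneg]
    exact toReal_mono hM (hGM x)
  · refine HasCompactSupport.intro (isCompact_closedBall (0 : Fin n → ℝ) k) fun x hx => ?_
    rw [hk x, toReal_zero]
    contrapose! hx
    rw [mem_closedBall_zero_iff, ← toReal_enorm]
    exact toReal_le_of_le_ofReal (by positivity) (by simpa using hx)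

lemma ofReal_abs_toReal {x : ℝ≥0∞} (hx : x ≠ ∞) : ENNReal.ofReal |x.toReal| = x := by
  rw [abs_of_nonneg toReal_nonneg, ofReal_toReal hx]

lemma avg_le_of_le {n : ℕ} {τ : ℝ} (hτ : 0 ≤ τ) {f : (Fin n → ℝ) → ℝ}
    {u : (Fin n → ℝ) → ℝ≥0∞} (hu : Measurable u) {Q Q' : Set (Fin n → ℝ)}
    (hQ : MeasurableSet Q) (hQQ' : Q ⊆ Q') {c : ℝ≥0∞}
    (h : ∀ x ∈ Q, ENNReal.ofReal |f x| ≤ u x ^ τ * c) :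
    avg τ f Q ≤ ((volume Q)⁻¹ * ∫⁻ y in Q', u y) ^ τ * c := by
  rcases hτ.eq_or_lt with rfl | hτ
  · simp only [avg, if_true, ENNReal.rpow_zero, one_mul] at h ⊢
    refine essSup_le_of_ae_le c ?_
    filter_upwards [ae_restrict_mem hQ] with x hx using h x hx
  · have hc : (c ^ (1 / τ)) ^ τ = c := by
      rw [← ENNReal.rpow_mul, one_div_mul_cancel hτ.ne', ENNReal.rpow_one]
    rw [avg, if_neg hτ.ne']
    calc ((volume Q)⁻¹ * ∫⁻ x in Q, ENNReal.ofReal |f x| ^ (1 / τ)) ^ τ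
        ≤ ((volume Q)⁻¹ * ∫⁻ x in Q, u x * c ^ (1 / τ)) ^ τ := by
          refine ENNReal.rpow_le_rpow (mul_le_mul' le_rfl
            (setLIntegral_mono' hQ fun x hx => ?_)) hτ.le
          calc ENNReal.ofReal |f x| ^ (1 / τ) ≤ (u x ^ τ * c) ^ (1 / τ) :=
                ENNReal.rpow_le_rpow (h x hx) (by positivity)
            _ = u x * c ^ (1 / τ) := by
                rw [ENNReal.mul_rpow_of_nonneg _ _ (by positivity), ← ENNReal.rpow_mul,
                  mul_one_div_cancel hτ.ne', ENNReal.rpow_one]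
      _ = ((volume Q)⁻¹ * ∫⁻ x in Q, u x) ^ τ * c := by
          rw [lintegral_mul_const _ hu, ← mul_assoc, ENNReal.mul_rpow_of_nonneg _ _ hτ.le, hc]
      _ ≤ _ := by gcongr

lemma rpow_neg_mul_rpow_le {x : ℝ≥0∞} {s t r : ℝ} (hs : 0 < s) (hr : 0 < r) (h : -t + s = r) :
    x ^ (-t) * x ^ s ≤ x ^ r := by
  rcases eq_or_ne x 0 with rfl | h0
  · rw [ENNReal.zero_rpow_of_pos hs, mul_zero]; exact zero_le
  rcases eq_or_ne x ∞ with rfl | ht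
  · rw [ENNReal.top_rpow_of_pos hr]; exact le_top
  · rw [← ENNReal.rpow_add _ _ h0 ht, h]

namespace DualWeights

variable {m n : ℕ} {a : Exponents m} (D : DualWeights a n)

/-- The averages of `g`, times a power of averages of `N` with respect to `u dx`, are controlled
by `Φ`. -/
def Admissible (N : (Fin n → ℝ) → ℝ≥0∞) (g : (Fin n → ℝ) → ℝ) (Φ : (Fin n → ℝ) → ℝ≥0∞) :
    Prop :=
  ∀ Q Q' A, IsCube Q → IsDilate Q Q' → MeasurableSet A → A ⊆ Q → ∀ x ∈ Q,
    avg (1 - a.σ) g Q * ((∫⁻ y in Q', D.u y)⁻¹ * ∫⁻ y in A, D.u y * N y) ^ (a.E - 1) ≤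
      ((volume Q)⁻¹ * ∫⁻ y in Q', D.u y) ^ (1 - a.σ) * Φ x

/-- The bound for an operator against test functions that follows from sparse domination. -/
def TestBound (N h : (Fin n → ℝ) → ℝ≥0∞) (A : ℝ≥0∞) : Prop :=
  ∀ (g : (Fin n → ℝ) → ℝ) (Φ : (Fin n → ℝ) → ℝ≥0∞), BddCompSupp g → D.Admissible N g Φ →
    ∫⁻ x, h x * ENNReal.ofReal |g x| ≤ A * ∫⁻ x, D.u x * N x * Φ x

lemma ae_eq_zero_of_N_ae_eq_zero {N h : (Fin n → ℝ) → ℝ≥0∞} {A : ℝ≥0∞} (hh : Measurable h)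
    (hE : 1 < a.E) (hT : D.TestBound N h A) (hN : N =ᵐ[volume] 0) : h =ᵐ[volume] 0 := by
  rw [← lintegral_eq_zero_iff hh, ← nonpos_iff_eq_zero]
  refine lintegral_le_of_forall_setLIntegral_le (b := 0) (by simp) fun k => ?_
  set B : Set (Fin n → ℝ) := {x | ‖x‖ₑ + (0 : (Fin n → ℝ) → ℝ≥0∞) x ≤ k}
  have hB : MeasurableSet B :=
    measurableSet_le (measurable_enorm.add measurable_const) measurable_const
  have hg : ∀ x, B.indicator (fun _ => (1 : ℝ≥0∞)) x ≤ 1 := fun x =>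
    Set.indicator_le_self' (fun _ _ => zero_le) x
  have hbdd : BddCompSupp fun x => (B.indicator (fun _ => (1 : ℝ≥0∞)) x).toReal :=
    bddCompSupp_toReal (measurable_const.indicator hB) one_ne_top hg (k := k) fun x hx =>
      Set.indicator_of_notMem (fun hxB => hx (by simpa [B] using hxB)) _
  have hadm : D.Admissible N (fun x => (B.indicator (fun _ => (1 : ℝ≥0∞)) x).toReal) 0 := by
    intro Q Q' A' _ _ _ _ x _
    have : ∫⁻ y in A', D.u y * N y = 0 := by
      refine le_antisymm ((setLIntegral_le_lintegral _ _).trans (le_of_eq ?_)) zero_le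
      rw [lintegral_congr_ae (g := 0)]
      · simp
      · filter_upwards [hN] with y hy
        simp [hy]
    rw [this, mul_zero, ENNReal.zero_rpow_of_pos (by linarith), mul_zero]
    exact zero_le
  have := hT _ 0 hbdd hadm
  simp only [Pi.zero_apply, mul_zero, lintegral_zero] at this
  refine le_trans (le_of_eq ?_) this
  rw [← lintegral_indicator hB]
  refine lintegral_congr fun x => ?_
  rw [ofReal_abs_toReal ((hg x).trans_lt one_lt_top).ne]
  by_cases hx : x ∈ B <;> simp [hx]

end DualWeights

lemma lintegral_mul_rpow_mul_rpow_le {n : ℕ} {u F G : (Fin n → ℝ) → ℝ≥0∞} (hu : Measurable u)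
    (hF : Measurable F) (hG : Measurable G) (hu0 : ∀ x, u x ≠ 0) (hut : ∀ x, u x ≠ ∞)
    {α β s : ℝ} (hα : 0 ≤ α) (hβ : 0 ≤ β) (hs : 0 < s) (hαβ : α + β = s) {Y : ℝ≥0∞}
    (hFY : ∫⁻ x, u x * F x ^ s ≤ Y) (hGY : ∫⁻ x, u x * G x ^ s ≤ Y) :
    ∫⁻ x, u x * (F x ^ α * G x ^ β) ≤ Y := by
  have h1 : α / s + β / s = 1 := by rw [← add_div, hαβ, div_self hs.ne']
  calc ∫⁻ x, u x * (F x ^ α * G x ^ β)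
      = ∫⁻ x, (u x * F x ^ s) ^ (α / s) * (u x * G x ^ s) ^ (β / s) := by
        refine lintegral_congr fun x => ?_
        rw [ENNReal.mul_rpow_of_nonneg _ _ (by positivity),
          ENNReal.mul_rpow_of_nonneg _ _ (by positivity), ← ENNReal.rpow_mul, ← ENNReal.rpow_mul,
          mul_div_cancel₀ _ hs.ne', mul_div_cancel₀ _ hs.ne', mul_mul_mul_comm,
          ← ENNReal.rpow_add _ _ (hu0 x) (hut x), h1, ENNReal.rpow_one]
    _ ≤ (∫⁻ x, u x * F x ^ s) ^ (α / s) * (∫⁻ x, u x * G x ^ s) ^ (β / s) :=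
        ENNReal.lintegral_mul_norm_pow_le (hu.mul (hF.pow_const _)).aemeasurable
          (hu.mul (hG.pow_const _)).aemeasurable (by positivity) (by positivity) h1
    _ ≤ Y ^ (α / s) * Y ^ (β / s) := by gcongr
    _ = Y := by
        rw [← ENNReal.rpow_add_of_nonneg _ _ (by positivity) (by positivity), h1, ENNReal.rpow_one]

lemma centeredMax_ne_zero {α : Type*} [MetricSpace α] [MeasurableSpace α] {μ : Measure α}
    {F : α → ℝ≥0∞} (hF : ∫⁻ y, F y ∂μ ≠ 0) {x : α}
    (hfin : ∀ k : ℕ, μ (Metric.ball x k) ≠ ∞) : centeredMax μ F x ≠ 0 := by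
  contrapose! hF
  have hball : ∀ k : ℕ, ∫⁻ y in Metric.ball x (k : ℝ), F y ∂μ = 0 := by
    intro k
    rcases Nat.eq_zero_or_pos k with rfl | hk
    · simp
    have h1 : (μ (Metric.ball x ((k : ℚ) : ℝ)))⁻¹ * ∫⁻ y in Metric.ball x ((k : ℚ) : ℝ), F y ∂μ
        ≤ centeredMax μ F x :=
      le_iSup (fun q : {q : ℚ // 0 < q} =>
        (μ (Metric.ball x (q.1 : ℝ)))⁻¹ * ∫⁻ y in Metric.ball x (q.1 : ℝ), F y ∂μ)
        ⟨k, by exact_mod_cast hk⟩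
    rw [hF, nonpos_iff_eq_zero, mul_eq_zero, ENNReal.inv_eq_zero] at h1
    simpa [hfin k] using h1
  rw [← setLIntegral_univ, ← Metric.iUnion_ball_nat x, setLIntegral_iUnion_of_directed]
  · simp [hball]
  · exact Monotone.directed_le fun i j hij => Metric.ball_subset_ball (by exact_mod_cast hij)

namespace DualWeights

variable {m n : ℕ} {a : Exponents m} (D : DualWeights a n)

lemma withDensity_ball_ne_top (x : Fin n → ℝ) (k : ℕ) :
    volume.withDensity D.u (Metric.ball x k) ≠ ∞ := by
  rw [withDensity_apply _ Metric.isOpen_ball.measurableSet]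
  rcases Nat.eq_zero_or_pos k with rfl | hk
  · simp
  have hk' : (0 : ℝ) < k := by exact_mod_cast hk
  set Q : Set (Fin n → ℝ) := Set.univ.pi fun i => Set.Ico (x i - k) (x i - k + 2 * k) with hQ
  have hsub : Metric.ball x (k : ℝ) ⊆ Q := by
    intro y hy i _
    rw [Metric.mem_ball, dist_pi_lt_iff hk'] at hy
    have h2 := hy i
    rw [Real.dist_eq, abs_lt] at h2
    simp only [Set.mem_Ico]
    constructor <;> linarith
  have hcube : IsCube Q := ⟨fun i => x i - k, 2 * k, by positivity, rfl⟩
  exact ((lintegral_mono_set hsub).trans_lt (D.setLIntegral_u_ne_top Q hcube).lt_top).ne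

/-- The maximal function of `N` with respect to `u dx`. -/
def M (N : (Fin n → ℝ) → ℝ≥0∞) : (Fin n → ℝ) → ℝ≥0∞ := centeredMax (volume.withDensity D.u) N

lemma measurable_M {N : (Fin n → ℝ) → ℝ≥0∞} (hN : Measurable N) : Measurable (D.M N) :=
  measurable_centeredMax _ hN

lemma ratio_le_M {N : (Fin n → ℝ) → ℝ≥0∞} (hN : Measurable N) {Q Q' A : Set (Fin n → ℝ)}
    (hQ' : IsDilate Q Q') (hA : MeasurableSet A) (hAQ : A ⊆ Q) {x : Fin n → ℝ} (hx : x ∈ Q) :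
    (∫⁻ y in Q', D.u y)⁻¹ * ∫⁻ y in A, D.u y * N y ≤ D.M N x :=
  inv_mul_setLIntegral_le_centeredMax D.measurable_u hN D.u_ne_zero hQ' hA hAQ
    (D.setLIntegral_u_ne_top Q' hQ'.1) hx

end DualWeights

namespace Exponents

variable {m : ℕ} (a : Exponents m)

lemma one_lt_E_div_ρ : 1 < a.E / a.ρ := (one_lt_div a.ρ_pos).2 a.lt_E

/-- For a fixed dimension, the maximal operators with respect to `u dx` are bounded on the
relevant Lebesgue space uniformly in `u`. -/
lemma exists_lintegral_M_le (n : ℕ) : ∃ C : ℝ≥0∞, C ≠ ∞ ∧ 1 ≤ C ∧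
    ∀ (D : DualWeights a n) (N : (Fin n → ℝ) → ℝ≥0∞), Measurable N →
      ∫⁻ x, D.u x * D.M N x ^ (a.E / a.ρ) ≤ C * ∫⁻ x, D.u x * N x ^ (a.E / a.ρ) := by
  obtain ⟨C, hC, h⟩ := exists_lintegral_mul_centeredMax_rpow_le n a.one_lt_E_div_ρ
  refine ⟨max C 1, by simp [hC], le_max_right _ _, fun D N hN => ?_⟩
  exact (h D.u N D.measurable_u hN).trans (mul_le_mul' (le_max_left _ _) le_rfl)

end Exponents

lemma exists_lintegral_le_of_one_le (n : ℕ) {m : ℕ} (a : Exponents m) (hρ1 : 1 ≤ a.ρ) :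
    ∃ C : ℝ≥0∞, C ≠ ∞ ∧ ∀ (D : DualWeights a n) (N h : (Fin n → ℝ) → ℝ≥0∞) (A : ℝ≥0∞),
      Measurable N → Measurable h → D.TestBound N h A →
      ∫⁻ x, D.u x * N x ^ (a.E / a.ρ) ≠ ∞ →
      ∫⁻ x, (h x * D.u x ^ a.d) ^ (1 / a.ρ) ≤
        (C * A) ^ (1 / a.ρ) * ∫⁻ x, D.u x * N x ^ (a.E / a.ρ) := by
  obtain ⟨C, hC, hC1, hCM⟩ := a.exists_lintegral_M_le n
  have hρ := a.ρ_pos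
  have hq := a.one_lt_E_div_ρ
  have hE1 : 1 < a.E := hρ1.trans_lt a.lt_E
  have hp1 : 1 / a.ρ ≤ 1 := by rw [div_le_one hρ]; exact hρ1
  refine ⟨C ^ a.ρ, rpow_ne_top_of_nonneg hρ.le hC, fun D N h A hN hh hT hX => ?_⟩
  set X := ∫⁻ x, D.u x * N x ^ (a.E / a.ρ) with hXdef
  rw [ENNReal.mul_rpow_of_nonneg _ _ (by positivity), ← ENNReal.rpow_mul,
    mul_one_div_cancel hρ.ne', ENNReal.rpow_one]
  have hMm := D.measurable_M hN
  have hNq : Measurable fun x => D.u x * N x ^ (a.E / a.ρ) := D.measurable_u.mul (hN.pow_const _)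
  have hMq : Measurable fun x => D.u x * D.M N x ^ (a.E / a.ρ) :=
    D.measurable_u.mul (hMm.pow_const _)
  by_cases hX0 : N =ᵐ[volume] 0
  · have h0 := D.ae_eq_zero_of_N_ae_eq_zero hh hE1 hT hX0
    rw [lintegral_congr_ae (g := 0)]
    · simp
    · filter_upwards [h0] with x hx
      simp only [Pi.zero_apply] at hx ⊢
      rw [hx, zero_mul, ENNReal.zero_rpow_of_pos (by positivity)]
  have hM0 : ∀ x, D.M N x ≠ 0 := by
    refine fun x => centeredMax_ne_zero ?_ fun k => D.withDensity_ball_ne_top x k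
    rw [lintegral_withDensity_eq_lintegral_mul _ D.measurable_u hN, Ne,
      lintegral_eq_zero_iff (D.measurable_u.mul hN)]
    contrapose! hX0
    filter_upwards [hX0] with x hx
    simpa [D.u_ne_zero x] using hx
  have hMX : ∫⁻ x, D.u x * D.M N x ^ (a.E / a.ρ) ≤ C * X := hCM D N hN
  have hMt : ∀ᵐ x, D.M N x ≠ ∞ := by
    filter_upwards [ae_lt_top hMq (hMX.trans_lt (mul_lt_top hC.lt_top hX.lt_top)).ne] with x hx h
    rw [h, ENNReal.top_rpow_of_pos (by linarith), ENNReal.mul_top (D.u_ne_zero x)] at hx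
    exact lt_irrefl _ hx
  refine lintegral_le_of_forall_setLIntegral_le (b := fun x => D.u x + (D.M N x)⁻¹)
    (fun x => add_ne_top.2 ⟨D.u_ne_top x, inv_ne_top.2 (hM0 x)⟩) fun k => ?_
  set B : Set (Fin n → ℝ) := {x | ‖x‖ₑ + (D.u x + (D.M N x)⁻¹) ≤ k}
  have hB : MeasurableSet B :=
    measurableSet_le (measurable_enorm.add (D.measurable_u.add hMm.inv)) measurable_const
  have hθ : 0 ≤ a.E - a.E / a.ρ := by
    rw [sub_nonneg]; exact div_le_self a.E_pos.le hρ1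
  have hσ : 0 ≤ 1 - a.σ := sub_nonneg.2 a.σ_le_one
  set θ := a.E - a.E / a.ρ with hθdef
  set g : (Fin n → ℝ) → ℝ≥0∞ := B.indicator fun x => D.u x ^ (1 - a.σ) * D.M N x ^ (-θ) with hg
  have hgm : Measurable g :=
    ((D.measurable_u.pow_const _).mul (hMm.pow_const _)).indicator hB
  have hgle : ∀ x, g x ≤ D.u x ^ (1 - a.σ) * D.M N x ^ (-θ) := fun x =>
    Set.indicator_le_self' (fun _ _ => zero_le) x
  have hkt : ((k : ℝ≥0∞) ^ (1 - a.σ) * (k : ℝ≥0∞) ^ θ) ≠ ∞ :=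
    mul_ne_top (rpow_ne_top_of_nonneg hσ (natCast_ne_top k))
      (rpow_ne_top_of_nonneg hθ (natCast_ne_top k))
  have hgk : ∀ x, g x ≤ (k : ℝ≥0∞) ^ (1 - a.σ) * (k : ℝ≥0∞) ^ θ := by
    intro x
    by_cases hx : x ∈ B
    · rw [hg, Set.indicator_of_mem hx, ENNReal.rpow_neg, ← ENNReal.inv_rpow]
      have hx' : ‖x‖ₑ + (D.u x + (D.M N x)⁻¹) ≤ k := hx
      have h1 : D.u x ≤ k := le_trans (le_trans le_self_add le_add_self) hx'
      have h2 : (D.M N x)⁻¹ ≤ k := le_trans (le_trans le_add_self le_add_self) hx'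
      gcongr
    · rw [hg, Set.indicator_of_notMem hx]; exact zero_le
  have hBx : ∀ x ∈ B, ‖x‖ₑ ≤ k := fun x (hx : ‖x‖ₑ + (D.u x + (D.M N x)⁻¹) ≤ k) =>
    le_trans le_self_add hx
  have hbdd : BddCompSupp fun x => (g x).toReal :=
    bddCompSupp_toReal hgm hkt hgk (k := k) fun x hx =>
      Set.indicator_of_notMem (fun hxB => hx (hBx x hxB)) _
  have hgt : ∀ x, ENNReal.ofReal |(g x).toReal| = g x := fun x =>
    ofReal_abs_toReal ((hgk x).trans_lt hkt.lt_top).ne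
  have hadm : D.Admissible N (fun x => (g x).toReal) (fun x => D.M N x ^ (a.E / a.ρ - 1)) := by
    intro Q Q' A' hQ hQ' hA' hAQ x hx
    set ν := (∫⁻ y in Q', D.u y)⁻¹ * ∫⁻ y in A', D.u y * N y with hν
    have hνM : ∀ y ∈ Q, ν ≤ D.M N y := fun y hy => D.ratio_le_M hN hQ' hA' hAQ hy
    have h1 : avg (1 - a.σ) (fun x => (g x).toReal) Q ≤
        ((volume Q)⁻¹ * ∫⁻ y in Q', D.u y) ^ (1 - a.σ) * ν ^ (-θ) := by
      refine avg_le_of_le hσ D.measurable_u hQ.measurableSet hQ'.subset fun y hy => ?_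
      rw [hgt y]
      refine (hgle y).trans (mul_le_mul' le_rfl ?_)
      rw [ENNReal.rpow_neg, ENNReal.rpow_neg, ENNReal.inv_le_inv]
      exact ENNReal.rpow_le_rpow (hνM y hy) hθ
    calc _ ≤ ((volume Q)⁻¹ * ∫⁻ y in Q', D.u y) ^ (1 - a.σ) * ν ^ (-θ) * ν ^ (a.E - 1) :=
          mul_le_mul' h1 le_rfl
      _ = ((volume Q)⁻¹ * ∫⁻ y in Q', D.u y) ^ (1 - a.σ) * (ν ^ (-θ) * ν ^ (a.E - 1)) :=
          mul_assoc _ _ _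
      _ ≤ _ := by
          refine mul_le_mul' le_rfl ((rpow_neg_mul_rpow_le (by linarith)
            (show 0 < a.E / a.ρ - 1 by linarith) (by rw [hθdef]; ring)).trans ?_)
          exact ENNReal.rpow_le_rpow (hνM x hx) (by linarith)
  have hfin : ∫⁻ x, h x * g x ≤ A * (C * X) := by
    have h1 := hT _ _ hbdd hadm
    simp only [hgt] at h1
    refine h1.trans (mul_le_mul' le_rfl ?_)
    have h2 := lintegral_mul_rpow_mul_rpow_le D.measurable_u hN hMm D.u_ne_zero D.u_ne_top
      (α := 1) (β := a.E / a.ρ - 1) (s := a.E / a.ρ) zero_le_one (by linarith) (by linarith)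
      (by ring) (Y := C * X) (le_mul_of_one_le_left zero_le hC1) hMX
    simpa only [ENNReal.rpow_one, mul_assoc] using h2
  calc ∫⁻ x in B, (h x * D.u x ^ a.d) ^ (1 / a.ρ)
      ≤ ∫⁻ x in B, (h x * g x) ^ (1 / a.ρ) *
          (D.u x * D.M N x ^ (a.E / a.ρ)) ^ (1 - 1 / a.ρ) := by
        refine lintegral_mono_ae ?_
        filter_upwards [ae_restrict_mem hB, ae_restrict_of_ae hMt] with x hxB hxt
        refine le_of_eq ?_
        rw [hg, Set.indicator_of_mem hxB]
        obtain ⟨t, ht⟩ := exists_eexp (D.u_ne_zero x) (D.u_ne_top x)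
        obtain ⟨s, hs⟩ := exists_eexp (hM0 x) hxt
        rw [ENNReal.mul_rpow_of_nonneg _ _ (by positivity),
          ENNReal.mul_rpow_of_nonneg _ _ (by positivity), mul_assoc]
        congr 1
        simp only [ht, hs, eexp_rpow, eexp_mul]
        congr 1
        rw [hθdef, show a.d = a.ρ - a.σ by rw [Exponents.ρ]; ring]
        field_simp
        ring
    _ ≤ ∫⁻ x, (h x * g x) ^ (1 / a.ρ) *
          (D.u x * D.M N x ^ (a.E / a.ρ)) ^ (1 - 1 / a.ρ) := setLIntegral_le_lintegral _ _
    _ ≤ (∫⁻ x, h x * g x) ^ (1 / a.ρ) *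
          (∫⁻ x, D.u x * D.M N x ^ (a.E / a.ρ)) ^ (1 - 1 / a.ρ) :=
        ENNReal.lintegral_mul_norm_pow_le (hh.mul hgm).aemeasurable hMq.aemeasurable
          (by positivity) (by linarith) (by ring)
    _ ≤ (A * (C * X)) ^ (1 / a.ρ) * (C * X) ^ (1 - 1 / a.ρ) := by
        have : 0 ≤ 1 - 1 / a.ρ := by linarith
        gcongr
    _ = C * A ^ (1 / a.ρ) * X := by
        rw [ENNReal.mul_rpow_of_nonneg _ _ (by positivity), mul_assoc,
          ← ENNReal.rpow_add_of_nonneg _ _ (by positivity) (by linarith),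
          add_sub_cancel, ENNReal.rpow_one]
        ring

lemma le_of_le_mul_rpow {ρ : ℝ} (hρ : 0 < ρ) {B Y : ℝ≥0∞} (hY : Y ≠ ∞)
    (h : Y ≤ B * Y ^ (1 - ρ)) : Y ≤ B ^ (1 / ρ) := by
  rcases eq_or_ne Y 0 with rfl | h0
  · exact zero_le
  have h1 : Y ^ ρ ≤ B := by
    obtain ⟨t, rfl⟩ := exists_eexp h0 hY
    calc eexp t ^ ρ = eexp t * (eexp t ^ (1 - ρ))⁻¹ := by
          rw [eexp_rpow, eexp_rpow, eexp_inv, eexp_mul]; congr 1; ring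
      _ ≤ (B * eexp t ^ (1 - ρ)) * (eexp t ^ (1 - ρ))⁻¹ := by gcongr
      _ = B := by
          rw [mul_assoc, ENNReal.mul_inv_cancel, mul_one] <;> rw [eexp_rpow]
          exacts [eexp_ne_zero _, eexp_ne_top _]
  calc Y = (Y ^ ρ) ^ (1 / ρ) := by
        rw [← ENNReal.rpow_mul, mul_one_div_cancel hρ.ne', ENNReal.rpow_one]
    _ ≤ _ := by gcongr

lemma exists_lintegral_le_of_lt_one (n : ℕ) {m : ℕ} (a : Exponents m) (hρ1 : a.ρ < 1) :
    ∃ C : ℝ≥0∞, C ≠ ∞ ∧ ∀ (D : DualWeights a n) (N h : (Fin n → ℝ) → ℝ≥0∞) (A : ℝ≥0∞),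
      Measurable N → Measurable h → (∀ x, h x ≠ ∞) → D.TestBound N h A →
      ∫⁻ x, (h x * D.u x ^ a.d) ^ (1 / a.ρ) ≤
        (C * A) ^ (1 / a.ρ) * ∫⁻ x, D.u x * N x ^ (a.E / a.ρ) := by
  have hρ := a.ρ_pos
  have hq := a.one_lt_E_div_ρ
  have hd := a.d_pos
  have hσ : 0 < 1 - a.σ := sub_pos.2 (a.σ_lt_ρ.trans hρ1)
  have hρd : 1 - a.σ - a.d = 1 - a.ρ := by rw [Exponents.ρ]; ring
  have hρ1' : 0 < 1 - a.ρ := sub_pos.2 hρ1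
  have hp : 0 < 1 / a.ρ := by positivity
  have hp1 : 0 < 1 / a.ρ - 1 := by rw [sub_pos, one_lt_div hρ]; exact hρ1
  obtain ⟨C, hC, hC1, hCM⟩ := a.exists_lintegral_M_le n
  obtain ⟨K, hK, hKw⟩ := exists_lintegral_weightedMax_le n hd
    (show a.d < 1 - a.σ by linarith)
  rw [hρd] at hKw
  refine ⟨C ^ a.ρ * K ^ (1 - a.ρ), mul_ne_top (rpow_ne_top_of_nonneg hρ.le hC)
    (rpow_ne_top_of_nonneg hρ1'.le hK), fun D N h A hN hh hht hT => ?_⟩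
  set X := ∫⁻ x, D.u x * N x ^ (a.E / a.ρ) with hXdef
  have hMm := D.measurable_M hN
  have hMX : ∫⁻ x, D.u x * D.M N x ^ (a.E / a.ρ) ≤ C * X := hCM D N hN
  have hwm : Measurable fun x => D.u x ^ a.d := D.measurable_u.pow_const _
  refine lintegral_le_of_forall_setLIntegral_le (b := fun x => h x + D.u x)
    (fun x => add_ne_top.2 ⟨hht x, D.u_ne_top x⟩) fun k => ?_
  set B : Set (Fin n → ℝ) := {x | ‖x‖ₑ + (h x + D.u x) ≤ k}
  have hB : MeasurableSet B :=
    measurableSet_le (measurable_enorm.add (hh.add D.measurable_u)) measurable_const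
  have hBh : ∀ x ∈ B, h x ≤ k := fun x (hx : ‖x‖ₑ + (h x + D.u x) ≤ k) =>
    le_trans (le_trans le_self_add le_add_self) hx
  have hBu : ∀ x ∈ B, D.u x ≤ k := fun x (hx : ‖x‖ₑ + (h x + D.u x) ≤ k) =>
    le_trans (le_trans le_add_self le_add_self) hx
  have hBx : ∀ x ∈ B, ‖x‖ₑ ≤ k := fun x (hx : ‖x‖ₑ + (h x + D.u x) ≤ k) =>
    le_trans le_self_add hx
  set g : (Fin n → ℝ) → ℝ≥0∞ := B.indicator fun x =>
    h x ^ (1 / a.ρ - 1) * D.u x ^ (a.d * (1 / a.ρ)) with hg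
  have hgm : Measurable g :=
    ((hh.pow_const _).mul (D.measurable_u.pow_const _)).indicator hB
  have hkt : ((k : ℝ≥0∞) ^ (1 / a.ρ - 1) * (k : ℝ≥0∞) ^ (a.d * (1 / a.ρ))) ≠ ∞ :=
    mul_ne_top (rpow_ne_top_of_nonneg hp1.le (natCast_ne_top k))
      (rpow_ne_top_of_nonneg (by positivity) (natCast_ne_top k))
  have hgk : ∀ x, g x ≤ (k : ℝ≥0∞) ^ (1 / a.ρ - 1) * (k : ℝ≥0∞) ^ (a.d * (1 / a.ρ)) := by
    intro x
    by_cases hx : x ∈ B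
    · rw [hg, Set.indicator_of_mem hx]
      have h1 := hBh x hx
      have h2 := hBu x hx
      gcongr
    · rw [hg, Set.indicator_of_notMem hx]; exact zero_le
  have hbdd : BddCompSupp fun x => (g x).toReal :=
    bddCompSupp_toReal hgm hkt hgk (k := k) fun x hx =>
      Set.indicator_of_notMem (fun hxB => hx (hBx x hxB)) _
  have hgt : ∀ x, ENNReal.ofReal |(g x).toReal| = g x := fun x =>
    ofReal_abs_toReal ((hgk x).trans_lt hkt.lt_top).ne
  set PG := weightedMax (1 - a.σ) D.u g with hPG
  have hPGm : Measurable PG := measurable_weightedMax _ D.measurable_u hgm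
  have hadm : D.Admissible N (fun x => (g x).toReal)
      (fun x => PG x * D.M N x ^ (a.E - 1)) := by
    intro Q Q' A' hQ hQ' hA' hAQ x hx
    have h1 := avg_le_rpow_mul hσ hgm.ennreal_toReal D.measurable_u D.u_ne_zero D.u_ne_top hQ hQ'
      (D.setLIntegral_u_ne_top Q' hQ'.1) hx
    simp only [hgt] at h1
    rw [← mul_assoc]
    exact mul_le_mul' h1 (ENNReal.rpow_le_rpow (D.ratio_le_M hN hQ' hA' hAQ hx)
      (sub_nonneg.2 a.one_le_E))
  set Y := ∫⁻ x in B, (h x * D.u x ^ a.d) ^ (1 / a.ρ) with hY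
  have hYt : Y ≠ ∞ := by
    have hvol : volume B ≠ ∞ := by
      refine ((measure_mono (t := Metric.closedBall (0 : Fin n → ℝ) k) fun x hx => ?_).trans_lt
        measure_closedBall_lt_top).ne
      rw [mem_closedBall_zero_iff, ← toReal_enorm]
      exact toReal_le_of_le_ofReal (by positivity) (by simpa using hBx x hx)
    refine (setLIntegral_lt_top_of_le_nnreal hvol
      ⟨(((k : ℝ≥0∞) * (k : ℝ≥0∞) ^ a.d) ^ (1 / a.ρ)).toNNReal, fun x hx => ?_⟩).ne
    rw [coe_toNNReal (rpow_ne_top_of_nonneg hp.le (mul_ne_top (natCast_ne_top k)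
      (rpow_ne_top_of_nonneg hd.le (natCast_ne_top k))))]
    have h1 := hBh x hx
    have h2 := hBu x hx
    gcongr
  have hhg : ∫⁻ x, h x * g x = Y := by
    rw [hY, ← lintegral_indicator hB]
    refine lintegral_congr fun x => ?_
    by_cases hx : x ∈ B
    · rw [hg, Set.indicator_of_mem hx, Set.indicator_of_mem hx, ← mul_assoc,
        ENNReal.mul_rpow_of_nonneg _ _ hp.le, ← ENNReal.rpow_mul]
      congr 1
      conv_rhs => rw [← add_sub_cancel 1 (1 / a.ρ), ENNReal.rpow_add_of_nonneg _ _ zero_le_one hp1.le,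
        ENNReal.rpow_one]
    · rw [hg, Set.indicator_of_notMem hx, Set.indicator_of_notMem hx, mul_zero]
  have hPGY : ∫⁻ x, D.u x * PG x ^ (1 / (1 - a.ρ)) ≤ K * Y := by
    refine (hKw D.u g D.measurable_u hgm D.u_ne_zero D.u_ne_top).trans
      (mul_le_mul' le_rfl (le_of_eq ?_))
    rw [hY, ← lintegral_indicator hB]
    refine lintegral_congr fun x => ?_
    by_cases hx : x ∈ B
    · rw [hg, Set.indicator_of_mem hx, Set.indicator_of_mem hx, mul_assoc,
        ENNReal.mul_rpow_of_nonneg _ _ (by positivity), ENNReal.mul_rpow_of_nonneg _ _ hp.le,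
        ← ENNReal.rpow_mul]
      obtain ⟨t, ht⟩ := exists_eexp (D.u_ne_zero x) (D.u_ne_top x)
      congr 1
      · congr 1
        field_simp
      · simp only [ht, eexp_rpow, eexp_mul]
        congr 1
        field_simp
        ring
    · rw [hg, Set.indicator_of_notMem hx, Set.indicator_of_notMem hx, zero_mul,
        ENNReal.zero_rpow_of_pos (by positivity)]
  have hNM : ∫⁻ x, D.u x * (N x ^ (1 / a.ρ) * D.M N x ^ ((a.E - 1) / a.ρ)) ≤ C * X :=
    lintegral_mul_rpow_mul_rpow_le D.measurable_u hN hMm D.u_ne_zero D.u_ne_top hp.le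
      (div_nonneg (sub_nonneg.2 a.one_le_E) hρ.le) (by linarith) (by ring)
      (le_mul_of_one_le_left zero_le hC1) hMX
  have hYle : Y ≤ (A * (C * X) ^ a.ρ * K ^ (1 - a.ρ)) * Y ^ (1 - a.ρ) := by
    have h1 := hT _ _ hbdd hadm
    simp only [hgt] at h1
    rw [hhg] at h1
    calc Y ≤ A * ∫⁻ x, D.u x * N x * (PG x * D.M N x ^ (a.E - 1)) := h1
      _ = A * ∫⁻ x, (D.u x * (N x ^ (1 / a.ρ) * D.M N x ^ ((a.E - 1) / a.ρ))) ^ a.ρ *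
            (D.u x * PG x ^ (1 / (1 - a.ρ))) ^ (1 - a.ρ) := by
          congr 1
          refine lintegral_congr fun x => ?_
          have h2 : D.u x = D.u x ^ a.ρ * D.u x ^ (1 - a.ρ) := by
            rw [← ENNReal.rpow_add _ _ (D.u_ne_zero x) (D.u_ne_top x), add_sub_cancel,
              ENNReal.rpow_one]
          rw [ENNReal.mul_rpow_of_nonneg _ _ hρ.le, ENNReal.mul_rpow_of_nonneg _ _ hρ.le,
            ENNReal.mul_rpow_of_nonneg _ _ hρ1'.le, ← ENNReal.rpow_mul, ← ENNReal.rpow_mul,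
            ← ENNReal.rpow_mul, one_div_mul_cancel hρ.ne', one_div_mul_cancel hρ1'.ne',
            div_mul_cancel₀ _ hρ.ne', ENNReal.rpow_one, ENNReal.rpow_one]
          nth_rewrite 1 [h2]
          ring
      _ ≤ A * ((∫⁻ x, D.u x * (N x ^ (1 / a.ρ) * D.M N x ^ ((a.E - 1) / a.ρ))) ^ a.ρ *
            (∫⁻ x, D.u x * PG x ^ (1 / (1 - a.ρ))) ^ (1 - a.ρ)) := by
          refine mul_le_mul' le_rfl (ENNReal.lintegral_mul_norm_pow_le ?_ ?_ hρ.le hρ1'.le (by ring))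
          · exact (D.measurable_u.mul ((hN.pow_const _).mul (hMm.pow_const _))).aemeasurable
          · exact (D.measurable_u.mul (hPGm.pow_const _)).aemeasurable
      _ ≤ A * ((C * X) ^ a.ρ * (K * Y) ^ (1 - a.ρ)) := by gcongr
      _ = _ := by rw [ENNReal.mul_rpow_of_nonneg K _ hρ1'.le]; ring
  calc Y ≤ (A * (C * X) ^ a.ρ * K ^ (1 - a.ρ)) ^ (1 / a.ρ) := le_of_le_mul_rpow hρ hYt hYle
    _ = (C ^ a.ρ * K ^ (1 - a.ρ) * A * X ^ a.ρ) ^ (1 / a.ρ) := by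
        rw [ENNReal.mul_rpow_of_nonneg C _ hρ.le]; congr 1; ring
    _ = _ := by
        rw [ENNReal.mul_rpow_of_nonneg _ (X ^ a.ρ) hp.le, ← ENNReal.rpow_mul X,
          mul_one_div_cancel hρ.ne', ENNReal.rpow_one]

lemma wnorm_eq_lnorm {n : ℕ} {ρ : ℝ} (hρ : 0 ≤ ρ) (f : (Fin n → ℝ) → ℝ) {w : (Fin n → ℝ) → ℝ}
    (hw : ∀ x, 0 < w x) :
    wnorm ρ f w = lnorm ρ fun x => ENNReal.ofReal |f x| * ENNReal.ofReal (w x) := by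
  have h : ∀ x, ‖f x * w x‖ₑ = ENNReal.ofReal |f x| * ENNReal.ofReal (w x) := fun x => by
    rw [Real.enorm_eq_ofReal_abs, abs_mul, abs_of_pos (hw x), ENNReal.ofReal_mul (abs_nonneg _)]
  rw [wnorm, lnorm, expOf]
  rcases hρ.eq_or_lt with rfl | hρ
  · simp only [if_true, eLpNorm_exponent_top, eLpNormEssSup, h]
  · have h1 : 0 < 1 / ρ := by positivity
    rw [if_neg hρ.ne', if_neg hρ.ne',
      eLpNorm_eq_lintegral_rpow_enorm_toReal (by simpa using hρ) ofReal_ne_top]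
    simp only [toReal_ofReal h1.le, h, one_div_one_div]

namespace DualWeights

variable {m n : ℕ} (a : Exponents m)

/-- The dual weights of a tuple of weights with finite weight constant. -/
def ofWeights (w : Fin m → (Fin n → ℝ) → ℝ) (hw : ∀ j, IsWeight (w j))
    (hW : wConst a.R (fun j => a.R j - a.δ j) a.σ w < ∞) : DualWeights a n :=
  have hprod : ∀ x, 0 < ∏ j, w j x := fun x => Finset.prod_pos fun j _ => (hw j).2 x
  have hsum : ∑ j, (a.R j - a.δ j) - a.σ = a.d := by rw [a.sum_eq]; ring
  have hv : ∀ j, Measurable fun x => ENNReal.ofReal (w j x)⁻¹ ^ (1 / a.δ j) := fun j =>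
    (hw j).1.inv.ennreal_ofReal.pow_const _
  have hu : Measurable fun x => ENNReal.ofReal (∏ j, w j x) ^ (1 / a.d) :=
    (Finset.measurable_prod _ fun j _ => (hw j).1).ennreal_ofReal.pow_const _
  have hv0 : ∀ j x, ENNReal.ofReal (w j x)⁻¹ ^ (1 / a.δ j) ≠ 0 := fun j x =>
    (ENNReal.rpow_pos (by simpa using (hw j).2 x) ofReal_ne_top).ne'
  have hu0 : ∀ x, ENNReal.ofReal (∏ j, w j x) ^ (1 / a.d) ≠ 0 := fun x =>
    (ENNReal.rpow_pos (by simpa using hprod x) ofReal_ne_top).ne'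
  have hle : ∀ Q, IsCube Q →
      (∏ j, ((volume Q)⁻¹ * ∫⁻ x in Q, ENNReal.ofReal (w j x)⁻¹ ^ (1 / a.δ j)) ^ a.δ j) *
        ((volume Q)⁻¹ * ∫⁻ x in Q, ENNReal.ofReal (∏ j, w j x) ^ (1 / a.d)) ^ a.d ≤
      wConst a.R (fun j => a.R j - a.δ j) a.σ w := by
    intro Q hQ
    refine le_trans (le_of_eq ?_) (le_iSup _ (⟨Q, hQ⟩ : {Q : Set (Fin n → ℝ) // IsCube Q}))
    have hδ : ∀ j, a.R j - (a.R j - a.δ j) = a.δ j := fun j => sub_sub_cancel _ _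
    simp only [hsum, hδ, avg, (a.δ_pos _).ne', a.d_pos.ne', if_false,
      abs_of_pos (hprod _), abs_of_pos (inv_pos.2 ((hw _).2 _))]
  have hpos : ∀ Q, IsCube Q → ∀ {f : (Fin n → ℝ) → ℝ≥0∞} {t : ℝ}, 0 < t → Measurable f →
      (∀ x, f x ≠ 0) → ((volume Q)⁻¹ * ∫⁻ x in Q, f x) ^ t ≠ 0 := by
    intro Q hQ f t ht hf hf0
    rw [Ne, ENNReal.rpow_eq_zero_iff_of_pos ht, mul_eq_zero, not_or]
    exact ⟨ENNReal.inv_ne_zero.2 hQ.volume_ne_top, setLIntegral_ne_zero hQ.volume_ne_zero hf hf0⟩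
  have hfin : ∀ Q, IsCube Q → ∀ {f : (Fin n → ℝ) → ℝ≥0∞} {t : ℝ}, 0 < t →
      ((volume Q)⁻¹ * ∫⁻ x in Q, f x) ^ t ≠ ∞ → ∫⁻ x in Q, f x ≠ ∞ := by
    intro Q hQ f t ht h h'
    rw [h', mul_top (ENNReal.inv_ne_zero.2 hQ.volume_ne_top), top_rpow_of_pos ht] at h
    exact h rfl
  { v := fun j x => ENNReal.ofReal (w j x)⁻¹ ^ (1 / a.δ j)
    u := fun x => ENNReal.ofReal (∏ j, w j x) ^ (1 / a.d)
    W := wConst a.R (fun j => a.R j - a.δ j) a.σ w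
    measurable_v := hv
    measurable_u := hu
    v_ne_zero := hv0
    v_ne_top := fun j x => rpow_ne_top_of_nonneg (one_div_nonneg.2 (a.δ_pos j).le) ofReal_ne_top
    u_ne_zero := hu0
    u_ne_top := fun x => rpow_ne_top_of_nonneg (one_div_nonneg.2 a.d_pos.le) ofReal_ne_top
    prod_eq_one := fun x => by
      have h1 : ∀ j, (ENNReal.ofReal (w j x)⁻¹ ^ (1 / a.δ j)) ^ a.δ j =
          ENNReal.ofReal (w j x)⁻¹ := fun j => by
        rw [← ENNReal.rpow_mul, one_div_mul_cancel (a.δ_pos j).ne', ENNReal.rpow_one]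
      simp only [h1]
      rw [← ENNReal.rpow_mul, one_div_mul_cancel a.d_pos.ne', ENNReal.rpow_one,
        ← ENNReal.ofReal_prod_of_nonneg fun j _ => (inv_pos.2 ((hw j).2 x)).le,
        ← ENNReal.ofReal_mul (Finset.prod_nonneg fun j _ => (inv_pos.2 ((hw j).2 x)).le),
        Finset.prod_inv_distrib, inv_mul_cancel₀ (hprod x).ne', ENNReal.ofReal_one]
    setLIntegral_v_ne_top := fun j Q hQ => by
      refine hfin Q hQ (a.δ_pos j) fun h => ?_
      have h1 := hle Q hQ
      have h2 : (∏ j, ((volume Q)⁻¹ * ∫⁻ x in Q, ENNReal.ofReal (w j x)⁻¹ ^ (1 / a.δ j)) ^ a.δ j)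
          = ∞ := by
        rw [← Finset.mul_prod_erase _ _ (Finset.mem_univ j), h]
        exact top_mul (Finset.prod_ne_zero_iff.2 fun i _ =>
          hpos Q hQ (a.δ_pos i) (hv i) (hv0 i))
      rw [h2, top_mul (hpos Q hQ a.d_pos hu hu0)] at h1
      exact hW.ne (top_le_iff.1 h1)
    setLIntegral_u_ne_top := fun Q hQ => by
      refine hfin Q hQ a.d_pos fun h => ?_
      have h1 := hle Q hQ
      rw [h, mul_top (Finset.prod_ne_zero_iff.2 fun i _ =>
          hpos Q hQ (a.δ_pos i) (hv i) (hv0 i))] at h1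
      exact hW.ne (top_le_iff.1 h1)
    le_W := hle }

variable {a}

lemma ofWeights_u_rpow {w : Fin m → (Fin n → ℝ) → ℝ} (hw : ∀ j, IsWeight (w j))
    (hW : wConst a.R (fun j => a.R j - a.δ j) a.σ w < ∞) (x : Fin n → ℝ) :
    (ofWeights a w hw hW).u x ^ a.d = ENNReal.ofReal (∏ j, w j x) := by
  change (ENNReal.ofReal (∏ j, w j x) ^ (1 / a.d)) ^ a.d = _
  rw [← ENNReal.rpow_mul, one_div_mul_cancel a.d_pos.ne', ENNReal.rpow_one]

lemma ofWeights_v_rpow {w : Fin m → (Fin n → ℝ) → ℝ} (hw : ∀ j, IsWeight (w j))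
    (hW : wConst a.R (fun j => a.R j - a.δ j) a.σ w < ∞) (j : Fin m) (x : Fin n → ℝ) :
    (ofWeights a w hw hW).v j x ^ (-a.δ j) = ENNReal.ofReal (w j x) := by
  change (ENNReal.ofReal (w j x)⁻¹ ^ (1 / a.δ j)) ^ (-a.δ j) = _
  rw [ENNReal.rpow_neg, ← ENNReal.rpow_mul, one_div_mul_cancel (a.δ_pos j).ne', ENNReal.rpow_one,
    ENNReal.ofReal_inv_of_pos ((hw j).2 x), inv_inv]

end DualWeights

/-- A bound for nonnegative functions satisfying the test bound, in terms of `N`. -/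
lemma exists_lintegral_le (n : ℕ) {m : ℕ} (a : Exponents m) :
    ∃ C : ℝ≥0∞, C ≠ ∞ ∧ ∀ (D : DualWeights a n) (N h : (Fin n → ℝ) → ℝ≥0∞) (A : ℝ≥0∞),
      Measurable N → Measurable h → (∀ x, h x ≠ ∞) → D.TestBound N h A →
      ∫⁻ x, D.u x * N x ^ (a.E / a.ρ) ≠ ∞ →
      ∫⁻ x, (h x * D.u x ^ a.d) ^ (1 / a.ρ) ≤
        (C * A) ^ (1 / a.ρ) * ∫⁻ x, D.u x * N x ^ (a.E / a.ρ) := by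
  rcases le_or_gt 1 a.ρ with hρ | hρ
  · obtain ⟨C, hC, h⟩ := exists_lintegral_le_of_one_le n a hρ
    exact ⟨C, hC, fun D N h' A hN hh _ hT hX => h D N h' A hN hh hT hX⟩
  · obtain ⟨C, hC, h⟩ := exists_lintegral_le_of_lt_one n a hρ
    exact ⟨C, hC, fun D N h' A hN hh ht hT _ => h D N h' A hN hh ht hT⟩

/-- The weighted estimate for functions `G` controlled by sparse forms of `f`; `G` need not be
measurable. -/
lemma exists_lnorm_le_of_sparse (n : ℕ) {m : ℕ} (a : Exponents m) :
    ∃ C : ℝ≥0∞, C ≠ ∞ ∧ ∀ (D : DualWeights a n) (f : Fin m → (Fin n → ℝ) → ℝ)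
      (G : (Fin n → ℝ) → ℝ≥0∞) (C₀ : ℝ≥0∞), (∀ j, Measurable (f j)) → (∀ x, G x ≠ ∞) →
      (∀ g, BddCompSupp g → ∫⁻ x, G x * ENNReal.ofReal |g x| ≤
        C₀ * ⨆ S : SparseFamily n,
          sparseForm (n := n) (m := m + 1) (Fin.snoc a.R (1 - a.σ)) S (Fin.snoc f g)) →
      (∀ j, lnorm (a.R j - a.δ j)
        (fun x => ENNReal.ofReal |f j x| * D.v j x ^ (-a.δ j)) ≠ ∞) →
      lnorm a.ρ (fun x => G x * D.u x ^ a.d) ≤ C * C₀ * D.W ^ a.γ *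
        ∏ j, lnorm (a.R j - a.δ j) fun x => ENNReal.ofReal |f j x| * D.v j x ^ (-a.δ j) := by
  have hρ := a.ρ_pos
  have hp : 0 < 1 / a.ρ := by positivity
  obtain ⟨C₁, hC₁, h₁⟩ := exists_lintegral_N_maxFn_le n a
  obtain ⟨C₂, hC₂, h₂⟩ := exists_lintegral_le n a
  refine ⟨C₂ * a.K n * C₁ ^ a.ρ, mul_ne_top (mul_ne_top hC₂ (a.K_ne_top n))
    (rpow_ne_top_of_nonneg hρ.le hC₁), fun D f G C₀ hf hGt hG hfin => ?_⟩
  set F : Fin m → (Fin n → ℝ) → ℝ≥0∞ := fun j x => ENNReal.ofReal |f j x| with hFdef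
  have hFm : ∀ j, Measurable (F j) := fun j => (hf j).abs.ennreal_ofReal
  set L := ∏ j, lnorm (a.R j - a.δ j) fun x => F j x * D.v j x ^ (-a.δ j) with hL
  have hLt : L ≠ ∞ := ENNReal.prod_ne_top fun j _ => hfin j
  have hPm : ∀ j, Measurable (D.maxFn F j) := fun j =>
    measurable_weightedMax _ (D.measurable_v j) (hFm j)
  have hX := h₁ D F hFm
  set X := ∫⁻ x, D.u x * D.N (D.maxFn F) x ^ (a.E / a.ρ)
  have hXt : X ≠ ∞ := ne_top_of_le_ne_top
    (mul_ne_top hC₁ (rpow_ne_top_of_nonneg hp.le hLt)) hX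
  have hu0 : ∀ x, D.u x ^ a.d ≠ 0 := fun x => (ENNReal.rpow_pos
    (pos_iff_ne_zero.2 (D.u_ne_zero x)) (D.u_ne_top x)).ne'
  have hut : ∀ x, D.u x ^ a.d ≠ ∞ := fun x => rpow_ne_top_of_nonneg a.d_pos.le (D.u_ne_top x)
  obtain ⟨φ, hφm, hφle, hφ⟩ := exists_measurable_le_lintegral_eq volume
    fun x => (G x * D.u x ^ a.d) ^ (1 / a.ρ)
  set h : (Fin n → ℝ) → ℝ≥0∞ := fun x => φ x ^ a.ρ * (D.u x ^ a.d)⁻¹ with hh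
  have hhm : Measurable h := (hφm.pow_const _).mul (D.measurable_u.pow_const _).inv
  have hhG : ∀ x, h x ≤ G x := fun x => by
    calc φ x ^ a.ρ * (D.u x ^ a.d)⁻¹
        ≤ ((G x * D.u x ^ a.d) ^ (1 / a.ρ)) ^ a.ρ * (D.u x ^ a.d)⁻¹ := by
          gcongr; exact hφle x
      _ = G x := by
          rw [← ENNReal.rpow_mul, one_div_mul_cancel hρ.ne', ENNReal.rpow_one, mul_assoc,
            ENNReal.mul_inv_cancel (hu0 x) (hut x), mul_one]
  have hhφ : ∀ x, (h x * D.u x ^ a.d) ^ (1 / a.ρ) = φ x := fun x => by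
    rw [hh]
    simp only
    rw [mul_assoc, ENNReal.inv_mul_cancel (hu0 x) (hut x), mul_one, ← ENNReal.rpow_mul,
      mul_one_div_cancel hρ.ne', ENNReal.rpow_one]
  have hT : D.TestBound (D.N (D.maxFn F)) h (C₀ * (a.K n * D.W ^ a.γ)) := by
    intro g Φ hg hadm
    calc ∫⁻ x, h x * ENNReal.ofReal |g x| ≤ ∫⁻ x, G x * ENNReal.ofReal |g x| :=
          lintegral_mono fun x => mul_le_mul' (hhG x) le_rfl
      _ ≤ _ := hG g hg
      _ ≤ C₀ * (a.K n * D.W ^ a.γ * ∫⁻ x, D.u x * D.N (D.maxFn F) x * Φ x) := by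
          refine mul_le_mul' le_rfl (iSup_le fun S => D.sparseForm_le S ?_ hadm)
          intro j Q Q' hQ hQ' x hx
          exact avg_le_rpow_mul (a.R_pos j) (hf j) (D.measurable_v j) (D.v_ne_zero j)
            (D.v_ne_top j) hQ hQ' (D.setLIntegral_v_ne_top j Q' hQ'.1) hx
      _ = _ := by ring
  have hfinal := h₂ D _ h _ (D.measurable_N hPm) hhm
    (fun x => ne_top_of_le_ne_top (hGt x) (hhG x)) hT hXt
  simp only [hhφ] at hfinal
  rw [lnorm, if_neg hρ.ne', hφ]
  calc (∫⁻ x, φ x) ^ a.ρ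
      ≤ ((C₂ * (C₀ * (a.K n * D.W ^ a.γ))) ^ (1 / a.ρ) * (C₁ * L ^ (1 / a.ρ))) ^ a.ρ := by
        gcongr
        exact hfinal.trans (mul_le_mul' le_rfl hX)
    _ = C₂ * (C₀ * (a.K n * D.W ^ a.γ)) * (C₁ ^ a.ρ * L) := by
        rw [ENNReal.mul_rpow_of_nonneg _ _ hρ.le, ENNReal.mul_rpow_of_nonneg _ _ hρ.le,
          ← ENNReal.rpow_mul, ← ENNReal.rpow_mul, one_div_mul_cancel hρ.ne', ENNReal.rpow_one,
          ENNReal.rpow_one]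
    _ = _ := by ring

/-- The exponents associated to the reciprocals of `r_j`, `p_j` and `s`. -/
def Exponents.ofInv {m : ℕ} (hm : 0 < m) (rinv pinv : Fin m → ℝ) (sinv : ℝ)
    (hs0 : 0 ≤ sinv) (hs1 : sinv ≤ 1) (hp0 : ∀ j, 0 ≤ pinv j) (hpr : ∀ j, pinv j < rinv j)
    (hs : sinv < ∑ j, pinv j) : Exponents m where
  R := rinv
  δ := fun j => rinv j - pinv j
  σ := sinv
  d := (∑ j, pinv j) - sinv
  γ := max (Finset.univ.sup' ⟨⟨0, hm⟩, Finset.mem_univ _⟩ fun j => rinv j / (rinv j - pinv j))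
    ((1 - sinv) / ((∑ j, pinv j) - sinv))
  δ_pos := fun j => sub_pos.2 (hpr j)
  δ_le := fun j => sub_le_self _ (hp0 j)
  R_le := fun j => by
    rw [← div_le_iff₀ (sub_pos.2 (hpr j))]
    exact le_max_of_le_left
      (Finset.le_sup' (fun j => rinv j / (rinv j - pinv j)) (Finset.mem_univ j))
  d_pos := sub_pos.2 hs
  σ_nonneg := hs0
  σ_le_one := hs1
  one_sub_le := by
    rw [← div_le_iff₀ (sub_pos.2 hs)]
    exact le_max_right _ _
  one_lt_γ := by
    obtain ⟨j, -, hj⟩ : ∃ j ∈ Finset.univ, 0 < pinv j := by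
      by_contra! h
      exact absurd (hs0.trans_lt hs) (Finset.sum_nonpos h).not_gt
    refine lt_max_of_lt_left ((Finset.lt_sup'_iff _).2 ⟨j, Finset.mem_univ j, ?_⟩)
    rw [one_lt_div (sub_pos.2 (hpr j))]
    exact sub_lt_self _ hj
  sum_eq := by simp

end Paper
namespace Paper

/-- **Quantitative weighted bounds from sparse domination beyond the Banach range**
(Corollary 4.2): if an `m`-linear (or positive-valued `m`-sublinear) operator `T` satisfies
the sparse form domination `⟨|T(f⃗)|,|g|⟩ ≲ sup_S Λ_{(r⃗,s'),S}(f⃗,g)` for all bounded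
compactly supported functions, then for all `p⃗ > (r⃗,s)` and all `w⃗ ∈ A_{p⃗,(r⃗,s)}`,
`T` extends to a bounded operator with norm
`≲ [w⃗]_{p⃗,(r⃗,s)}^{max((1/r_j)/(1/r_j-1/p_j), (1-1/s)/(1/p-1/s))}`. -/
theorem sparse_domination_extrapolated_bound
    (n m : ℕ) (hm : 0 < m) (rinv : Fin m → ℝ) (sinv : ℝ)
    (hr : ∀ j, 0 < rinv j) (hs0 : 0 ≤ sinv) (hs1 : sinv ≤ 1)
    (T : (Fin m → (Fin n → ℝ) → ℝ) → (Fin n → ℝ) → ℝ)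
    (hT : IsMLinear T ∨ IsMSublinearPos T)
    (C₀ : ℝ≥0∞) (hC₀ : C₀ < ∞)
    (hsparse : ∀ (f : Fin m → (Fin n → ℝ) → ℝ) (g : (Fin n → ℝ) → ℝ),
      (∀ j, BddCompSupp (f j)) → BddCompSupp g →
      (∫⁻ x, ENNReal.ofReal |T f x| * ENNReal.ofReal |g x|) ≤
        C₀ * ⨆ S : SparseFamily n,
          sparseForm (Fin.snoc rinv (1 - sinv)) S (Fin.snoc f g)) :
    ∀ pinv : Fin m → ℝ, (∀ j, 0 ≤ pinv j) → (∀ j, pinv j < rinv j) →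
      sinv < ∑ j, pinv j →
      ∃ C : ℝ≥0∞, 0 < C ∧ C < ∞ ∧
        ∀ w : Fin m → (Fin n → ℝ) → ℝ, (∀ j, IsWeight (w j)) →
          wConst rinv pinv sinv w < ∞ →
        ∃ T' : (Fin m → (Fin n → ℝ) → ℝ) → (Fin n → ℝ) → ℝ,
          (∀ f, (∀ j, BddCompSupp (f j)) → T' f = T f) ∧
          ∀ f : Fin m → (Fin n → ℝ) → ℝ, (∀ j, Measurable (f j)) →
            (∀ j, wnorm (pinv j) (f j) (w j) < ∞) →
            wnorm (∑ j, pinv j) (T' f) (fun x => ∏ j, w j x) ≤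
              C * wConst rinv pinv sinv w ^
                  (max
                    (Finset.univ.sup' ⟨⟨0, hm⟩, Finset.mem_univ _⟩ fun j =>
                      rinv j / (rinv j - pinv j))
                    ((1 - sinv) / ((∑ j, pinv j) - sinv))) *
                ∏ j, wnorm (pinv j) (f j) (w j) := by
  classical
  intro pinv hp0 hpr hs
  set a := Exponents.ofInv hm rinv pinv sinv hs0 hs1 hp0 hpr hs
  obtain ⟨C, hC, h⟩ := exists_lnorm_le_of_sparse n a
  have hρ : a.ρ = ∑ j, pinv j := add_sub_cancel sinv (∑ j, pinv j)
  have hpinv : ∀ j, a.R j - a.δ j = pinv j := fun j => sub_sub_cancel (rinv j) (pinv j)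
  refine ⟨C * C₀ + 1, by positivity, add_lt_top.2 ⟨mul_lt_top hC.lt_top hC₀, one_lt_top⟩,
    fun w hw hW => ⟨fun f => if ∀ j, BddCompSupp (f j) then T f else 0,
      fun f hf => if_pos hf, fun f hfm hfin => ?_⟩⟩
  beta_reduce
  by_cases hf : ∀ j, BddCompSupp (f j)
  swap
  · rw [if_neg hf]
    simp [wnorm]
  have hprod : ∀ x, 0 < ∏ j, w j x := fun x => Finset.prod_pos fun j _ => (hw j).2 x
  have hWa : wConst a.R (fun j => a.R j - a.δ j) a.σ w = wConst rinv pinv sinv w := by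
    simp only [hpinv]; rfl
  have hW' : wConst a.R (fun j => a.R j - a.δ j) a.σ w < ∞ := hWa ▸ hW
  set D := DualWeights.ofWeights a w hw hW' with hD
  have hDW : D.W = wConst rinv pinv sinv w := hWa
  have hnorm : ∀ j, lnorm (a.R j - a.δ j)
      (fun x => ENNReal.ofReal |f j x| * D.v j x ^ (-a.δ j)) = wnorm (pinv j) (f j) (w j) := by
    intro j
    rw [wnorm_eq_lnorm (hp0 j) _ (hw j).2, hpinv]
    simp only [hD, DualWeights.ofWeights_v_rpow]
  have key := h D f (fun x => ENNReal.ofReal |T f x|) C₀ hfm (fun _ => ofReal_ne_top)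
    (fun g hg => hsparse f g hf hg) (fun j => by rw [hnorm j]; exact (hfin j).ne)
  simp only [hnorm] at key
  rw [if_pos hf, wnorm_eq_lnorm (Finset.sum_nonneg fun j _ => hp0 j) _ hprod]
  simp only [hD, DualWeights.ofWeights_u_rpow, hρ] at key
  rw [← hD, hDW] at key
  exact key.trans (mul_le_mul' (mul_le_mul' le_self_add le_rfl) le_rfl)

end Paper
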